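/- arXiv:1903.01393 — 3 statements merged into one kernel-verified Lean document; each statement's English description precedes it below -/
import Mathlib

section
/- For all n ≥ 4, the number |Arith(D_n)| of arithmetical structures on the bident D_n satisfies 2·C(n−2) + C(n−3) ≤ |Arith(D_n)| < 2·C(n−2) + 702·C(n−3). -/
/-- `IsArith n dx dy d rx ry r` says that `(d, r)` is an arithmetical structure on the
bident `D_n` (with `ℓ = n - 3`): `dx, dy, rx, ry` are the values at the prong vertices
`v_x, v_y`, and `d i, r i` (for `0 ≤ i ≤ n - 3`) are the values at the path vertices
`v_0, v_1, …, v_ℓ`. -/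
def IsArith (n dx dy : ℕ) (d : ℕ → ℕ) (rx ry : ℕ) (r : ℕ → ℕ) : Prop :=
  3 ≤ n ∧
  0 < dx ∧ 0 < dy ∧ (∀ i, i ≤ n - 3 → 0 < d i) ∧
  0 < rx ∧ 0 < ry ∧ (∀ i, i ≤ n - 3 → 0 < r i) ∧
  dx * rx = r 0 ∧ dy * ry = r 0 ∧
  (1 ≤ n - 3 → d 0 * r 0 = rx + ry + r 1) ∧
  (n - 3 = 0 → d 0 * r 0 = rx + ry) ∧
  (∀ i, 1 ≤ i → i + 1 ≤ n - 3 → d i * r i = r (i - 1) + r (i + 1)) ∧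
  (1 ≤ n - 3 → d (n - 3) * r (n - 3) = r (n - 3 - 1)) ∧
  (∀ c : ℕ, c ∣ rx → c ∣ ry → (∀ i, i ≤ n - 3 → c ∣ r i) → c = 1)

/-- An arithmetical structure on `D_n` is *smooth* if `d_x, d_y ≥ 2` and `d_i ≥ 2` for all
`1 ≤ i ≤ ℓ = n - 3`. -/
def IsSmooth (n dx dy : ℕ) (d : ℕ → ℕ) : Prop :=
  2 ≤ dx ∧ 2 ≤ dy ∧ ∀ i, 1 ≤ i → i ≤ n - 3 → 2 ≤ d i

/-- The type of arithmetical structures on the bident `D_n`, represented canonically: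
the label functions `d, r` are required to vanish beyond index `n - 3`. -/
structure ArithOn (n : ℕ) where
  dx : ℕ
  dy : ℕ
  d : ℕ → ℕ
  rx : ℕ
  ry : ℕ
  r : ℕ → ℕ
  arith : IsArith n dx dy d rx ry r
  d_pad : ∀ i, n - 3 < i → d i = 0
  r_pad : ∀ i, n - 3 < i → r i = 0

/-- The type of smooth arithmetical structures on the bident `D_n`, represented canonically. -/
structure SmoothArithOn (n : ℕ) where
  dx : ℕ
  dy : ℕ
  d : ℕ → ℕ
  rx : ℕ
  ry : ℕ
  r : ℕ → ℕ
  arith : IsArith n dx dy d rx ry r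
  smooth : IsSmooth n dx dy d
  d_pad : ∀ i, n - 3 < i → d i = 0
  r_pad : ∀ i, n - 3 < i → r i = 0

/-- The ballot numbers `[z^ℓ] z^m T(z)^(m+1)`, where `T` is the Catalan generating function. -/
def ballot : ℕ → ℕ → ℕ
  | 0, m => if m = 0 then 1 else 0
  | ℓ + 1, m => ∑ k ∈ Finset.range (ℓ + 1 - (m - 1)), ballot ℓ (m - 1 + k)

theorem ballot_eq_zero {ℓ m : ℕ} (h : ℓ < m) : ballot ℓ m = 0 := by
  cases ℓ with
  | zero => simp [ballot]; omega
  | succ ℓ =>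
    have : ℓ + 1 - (m - 1) = 0 := by omega
    simp [ballot, this]

theorem ballot_succ_zero (ℓ : ℕ) : ballot (ℓ + 1) 0 = ballot (ℓ + 1) 1 := by
  simp [ballot]

theorem ballot_succ_succ (ℓ m : ℕ) :
    ballot (ℓ + 1) (m + 1) = ballot ℓ m + ballot (ℓ + 1) (m + 2) := by
  rcases le_or_gt m ℓ with h | h
  · obtain ⟨k, rfl⟩ := Nat.exists_eq_add_of_le h
    have h₁ : m + k + 1 - (m + 1 - 1) = k + 1 := by omega
    have h₂ : m + k + 1 - (m + 2 - 1) = k := by omega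
    rw [ballot, ballot, h₁, h₂, Finset.sum_range_succ', add_comm]
    congr 1
    exact Finset.sum_congr rfl fun i _ => by congr 1; omega
  · rw [ballot_eq_zero h, ballot_eq_zero (by omega), ballot_eq_zero (by omega)]

theorem sum_ballot (ℓ : ℕ) : ∑ m ∈ Finset.range (ℓ + 1), ballot ℓ m = ballot (ℓ + 1) 0 := by
  simp [ballot]

theorem ballot_add_eq (k : ℕ) : ∀ m : ℕ, (ballot (k + m) m : ℚ) =
    (m + 1) * (2 * k + m).factorial / (k.factorial * (k + m + 1).factorial) := by
  induction k with
  | zero =>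
    intro m
    have hm : ballot m m = 1 := by
      induction m with
      | zero => rfl
      | succ m ih => rw [ballot_succ_succ, ih, ballot_eq_zero (by omega)]
    have := Nat.factorial_ne_zero m
    simp [hm, Nat.factorial_succ]
    field_simp
  | succ k ihk =>
    intro m
    induction m with
    | zero =>
      have h := ihk 1
      rw [add_zero, ballot_succ_zero, h]
      have e₁ : 2 * (k + 1) + 0 = 2 * k + 1 + 1 := by ring
      have e₂ : k + 1 + 0 + 1 = k + 1 + 1 := by ring
      rw [e₁, e₂, Nat.factorial_succ (2 * k + 1), Nat.factorial_succ k]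
      have := Nat.factorial_ne_zero k
      have := Nat.factorial_ne_zero (k + 1 + 1)
      push_cast
      field_simp
      ring
    | succ m ihm =>
      have h := ihk (m + 2)
      have e₀ : k + 1 + (m + 1) = k + 1 + m + 1 := by ring
      have e₁ : k + (m + 2) = k + 1 + m + 1 := by ring
      have e₂ : 2 * (k + 1) + (m + 1) = 2 * (k + 1) + m + 1 := by ring
      have e₃ : 2 * k + (m + 2) = 2 * (k + 1) + m := by ring
      rw [e₁, e₃] at h
      rw [e₀, ballot_succ_succ, Nat.cast_add, ihm, h, e₂,
        Nat.factorial_succ (2 * (k + 1) + m), Nat.factorial_succ k,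
        Nat.factorial_succ (k + 1 + m + 1)]
      have := Nat.factorial_ne_zero k
      have := Nat.factorial_ne_zero (k + 1 + m + 1)
      have : (k + 1 + m + 1 + 1 : ℚ) ≠ 0 := by positivity
      push_cast
      field_simp
      ring

theorem ballot_zero_right (ℓ : ℕ) : ballot ℓ 0 = catalan ℓ := by
  have h₁ := ballot_add_eq ℓ 0
  have h₂ := succ_mul_catalan_eq_centralBinom ℓ
  have h₃ := Nat.centralBinom_eq_two_mul_choose ℓ
  have h₄ := Nat.choose_mul_factorial_mul_factorial (show ℓ ≤ 2 * ℓ by omega)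
  rw [← h₃, ← h₂, show 2 * ℓ - ℓ = ℓ by omega] at h₄
  have h₅ : (((ℓ + 1) * catalan ℓ * ℓ.factorial * ℓ.factorial : ℕ) : ℚ)
      = ((2 * ℓ).factorial : ℕ) := by rw [h₄]
  rw [add_zero, add_zero, ← h₅, Nat.factorial_succ] at h₁
  have := Nat.factorial_ne_zero ℓ
  push_cast at h₁
  field_simp at h₁
  simp at h₁
  exact_mod_cast h₁

theorem ballot_succ_le {ℓ m : ℕ} :
    (ballot ℓ (m + 1) : ℚ) * (2 * (m + 1)) ≤ (m + 2) * ballot ℓ m := by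
  rcases Nat.lt_or_ge ℓ (m + 1) with h | h
  · rw [ballot_eq_zero h]
    simp only [Nat.cast_zero, zero_mul]
    positivity
  · obtain ⟨k, rfl⟩ := Nat.exists_eq_add_of_le' h
    have h₁ := ballot_add_eq k (m + 1)
    have h₂ := ballot_add_eq (k + 1) m
    rw [show k + 1 + m = k + (m + 1) by ring, show 2 * (k + 1) + m = 2 * k + (m + 1) + 1 by ring,
      Nat.factorial_succ (2 * k + (m + 1)), Nat.factorial_succ k] at h₂
    have h₃ : (ballot (k + (m + 1)) m : ℚ) * ((m + 2) * (2 * (k + 1))) =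
        ballot (k + (m + 1)) (m + 1) * ((m + 1) * (2 * (2 * k + (m + 1) + 1))) := by
      rw [h₁, h₂]
      have := Nat.factorial_ne_zero k
      push_cast
      field_simp
      ring
    have h₄ : (0 : ℚ) ≤ ballot (k + (m + 1)) (m + 1) := by positivity
    have hk : (0 : ℚ) < k + 1 := by positivity
    have h₅ : (0 : ℚ) ≤ ballot (k + (m + 1)) (m + 1) * ((m + 1) * m) := by positivity
    refine le_of_mul_le_mul_right ?_ (show (0 : ℚ) < 2 * (k + 1) by positivity)
    linarith

theorem ballot_le (ℓ m : ℕ) : (ballot ℓ m : ℚ) ≤ catalan ℓ * ((m + 1) / 2 ^ m) := by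
  induction m with
  | zero => simp [ballot_zero_right]
  | succ m ih =>
    have h := ballot_succ_le (ℓ := ℓ) (m := m)
    have h' : (ballot ℓ (m + 1) : ℚ) ≤ (m + 2) / (2 * (m + 1)) * ballot ℓ m := by
      rw [div_mul_eq_mul_div, le_div_iff₀ (by positivity)]
      exact h
    calc (ballot ℓ (m + 1) : ℚ) ≤ (m + 2) / (2 * (m + 1)) * ballot ℓ m := h'
      _ ≤ (m + 2) / (2 * (m + 1)) * (catalan ℓ * ((m + 1) / 2 ^ m)) := by gcongr
      _ = catalan ℓ * (((m + 1 : ℕ) + 1) / 2 ^ (m + 1)) := by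
        push_cast
        field_simp
        ring

/-- The length of the Hirzebruch–Jung continued fraction of `1 / Int.fract α`, or `0` if `α` is an
integer. -/
noncomputable def hjLength (α : ℚ) : ℕ :=
  if h : Int.fract α = 0 then 0 else hjLength (-(Int.fract α)⁻¹) + 1
termination_by α.den
decreasing_by
  have h₀ : 0 < Int.fract α := lt_of_le_of_ne (Int.fract_nonneg α) (Ne.symm h)
  have h₁ : (Int.fract α).num < (Int.fract α).den :=
    Rat.num_lt_denom_iff.2 (Int.fract_lt_one α)
  have h₂ : (Int.fract α).den = α.den := by
    rw [Int.fract, Rat.sub_intCast_den]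
  have h₃ := Rat.num_pos.2 h₀
  rw [Rat.neg_den, Rat.den_inv, if_neg h₃.ne']
  omega

theorem hjLength_of_fract_eq_zero {α : ℚ} (h : Int.fract α = 0) : hjLength α = 0 := by
  rw [hjLength, dif_pos h]

theorem hjLength_of_fract_ne_zero {α : ℚ} (h : Int.fract α ≠ 0) :
    hjLength α = hjLength (-(Int.fract α)⁻¹) + 1 := by
  rw [hjLength, dif_neg h]

theorem hjLength_add_intCast (α : ℚ) (j : ℤ) : hjLength (α + j) = hjLength α := by
  have h := Int.fract_add_intCast α j
  by_cases h₀ : Int.fract α = 0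
  · rw [hjLength_of_fract_eq_zero h₀, hjLength_of_fract_eq_zero (h.trans h₀)]
  · rw [hjLength_of_fract_ne_zero h₀, hjLength_of_fract_ne_zero (by rwa [h]), h]

theorem hjLength_sub_one (α : ℚ) : hjLength (α - 1) = hjLength α := by
  simpa [sub_eq_add_neg] using hjLength_add_intCast α (-1)

theorem hjLength_neg_inv_add_one {y : ℚ} (hy : 0 < y) :
    hjLength (-(y + 1)⁻¹) = hjLength (-y⁻¹) + 1 := by
  have h : Int.fract (-(y + 1)⁻¹) = y / (y + 1) := by
    rw [Int.fract_eq_iff]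
    refine ⟨by positivity, (div_lt_one (by positivity)).2 (by linarith), -1, ?_⟩
    push_cast
    field_simp
    ring
  rw [hjLength_of_fract_ne_zero (by rw [h]; positivity), h, ← hjLength_sub_one (-y⁻¹)]
  congr 2
  field_simp
  ring

theorem hjLength_neg_inv_add_natCast {y : ℚ} (hy : 0 < y) (k : ℕ) :
    hjLength (-(y + k)⁻¹) = hjLength (-y⁻¹) + k := by
  induction k with
  | zero => simp
  | succ k ih =>
    rw [Nat.cast_succ, ← add_assoc, hjLength_neg_inv_add_one (by positivity), ih, add_assoc]

theorem hjLength_neg_inv_natCast_succ (k : ℕ) : hjLength (-((k : ℚ) + 1)⁻¹) = k := by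
  have h := hjLength_neg_inv_add_natCast one_pos k
  rw [add_comm, h, hjLength_of_fract_eq_zero, zero_add]
  rw [inv_one, show (-1 : ℚ) = ((-1 : ℤ) : ℚ) by norm_num, Int.fract_intCast]

/-- If `q ∈ (0, 1]` is congruent to `α` modulo `1` then passing to `-1 / q` removes the first entry
of the continued fraction. -/
theorem hjLength_neg_inv {α q : ℚ} {j : ℤ} (hq : 0 < q) (hq₁ : q ≤ 1) (h : q = α + j) :
    hjLength (-q⁻¹) = hjLength α - 1 := by
  rw [← hjLength_add_intCast α j, ← h]
  rcases hq₁.lt_or_eq with h₁ | rfl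
  · have hf : Int.fract q = q := Int.fract_eq_self.2 ⟨hq.le, h₁⟩
    rw [hjLength_of_fract_ne_zero (α := q) (by rw [hf]; exact hq.ne'), hf]
    rfl
  · rw [hjLength_of_fract_eq_zero, hjLength_of_fract_eq_zero Int.fract_one]
    rw [inv_one, show (-1 : ℚ) = ((-1 : ℤ) : ℚ) by norm_num, Int.fract_intCast]

theorem le_hjLength_add_one (x : ℚ) : x ≤ hjLength (-x⁻¹) + 1 := by
  by_contra! h
  set m := hjLength (-x⁻¹) with hm
  have h' := hjLength_neg_inv_add_natCast (show 0 < x - (m + 1) by linarith) (m + 1)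
  rw [Nat.cast_add_one, sub_add_cancel, ← hm] at h'
  omega

/-- The number `-1/a - 1/b`, to which the quotient `r₁ / r₀` of an arithmetical structure with prong
values `a`, `b` is congruent modulo `1`. -/
def prong (a b : ℕ) : ℚ := -(a : ℚ)⁻¹ - (b : ℚ)⁻¹

theorem prong_eq {a b : ℕ} (ha : 0 < a) (hb : 0 < b) :
    prong a b = -((a * b : ℚ) / (a + b))⁻¹ := by
  have : (0 : ℚ) < a := by exact_mod_cast ha
  have : (0 : ℚ) < b := by exact_mod_cast hb
  rw [prong]
  field_simp
  ring

theorem prong_comm (a b : ℕ) : prong a b = prong b a := by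
  rw [prong, prong]; ring

theorem hjLength_prong_one {b : ℕ} (hb : 0 < b) : hjLength (prong 1 b) = b - 1 := by
  obtain ⟨k, rfl⟩ := Nat.exists_eq_add_of_le' hb
  have h := hjLength_neg_inv_natCast_succ k
  rw [← hjLength_sub_one] at h
  rw [show k + Nat.succ 0 - 1 = k by omega]
  refine Eq.trans (congrArg hjLength ?_) h
  rw [prong]
  push_cast
  ring

theorem mul_le_of_hjLength_prong {a b m : ℕ} (ha : 0 < a) (hb : 0 < b)
    (hm : hjLength (prong a b) ≤ m) : a * b ≤ (m + 1) * (a + b) := by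
  refine le_trans ?_ (Nat.mul_le_mul_right _ (Nat.add_le_add_right hm 1))
  have ha' : (0 : ℚ) < a := by exact_mod_cast ha
  have hb' : (0 : ℚ) < b := by exact_mod_cast hb
  have h := le_hjLength_add_one ((a * b : ℚ) / (a + b))
  rw [← prong_eq ha hb, div_le_iff₀ (by positivity)] at h
  exact_mod_cast h

theorem add_le_of_hjLength_prong {a b m : ℕ} (ha : 0 < a) (hb : 0 < b)
    (hm : hjLength (prong a b) ≤ m) (h : a ≤ m + 1) : a + b ≤ a ^ 2 * (m + 3 - a) := by
  have ha' : (0 : ℚ) < a := by exact_mod_cast ha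
  have hb' : (0 : ℚ) < b := by exact_mod_cast hb
  rcases le_or_gt (a + b) (a ^ 2) with h₁ | h₁
  · exact h₁.trans (Nat.le_mul_of_pos_right _ (by omega))
  · have h₁' : (0 : ℚ) < a + b - a ^ 2 := by
      rw [sub_pos]; exact_mod_cast h₁
    obtain ⟨c, rfl⟩ := Nat.exists_eq_add_of_le' ha
    have hy : 0 < ((c + 1 : ℕ) + b - (c + 1 : ℕ) ^ 2 : ℚ) / ((c + 1 : ℕ) + b) := by positivity
    have h₂ := hjLength_neg_inv_add_natCast hy c
    have h₃ : ((c + 1 : ℕ) + b - (c + 1 : ℕ) ^ 2 : ℚ) / ((c + 1 : ℕ) + b) + c =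
        ((c + 1 : ℕ) * b : ℚ) / ((c + 1 : ℕ) + b) := by
      field_simp
      push_cast
      ring
    have h₄ := le_hjLength_add_one
      (((c + 1 : ℕ) + b - (c + 1 : ℕ) ^ 2 : ℚ) / (c + 1 : ℕ) ^ 2)
    have h₅ : hjLength (-(((c + 1 : ℕ) + b - (c + 1 : ℕ) ^ 2 : ℚ) / ((c + 1 : ℕ) + b))⁻¹) =
        hjLength (-(((c + 1 : ℕ) + b - (c + 1 : ℕ) ^ 2 : ℚ) / (c + 1 : ℕ) ^ 2)⁻¹) := by
      rw [← hjLength_sub_one (-(_ / (c + 1 : ℕ) ^ 2 : ℚ)⁻¹)]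
      congr 1
      field_simp
      ring
    rw [h₃, ← prong_eq ha hb, h₅] at h₂
    obtain ⟨e, he⟩ : ∃ e, e = hjLength
        (-(((c + 1 : ℕ) + b - (c + 1 : ℕ) ^ 2 : ℚ) / (c + 1 : ℕ) ^ 2)⁻¹) := ⟨_, rfl⟩
    rw [← he] at h₂ h₄
    rw [div_le_iff₀ (by positivity)] at h₄
    refine le_trans ?_ (Nat.mul_le_mul_left _ (show e + 2 ≤ m + 3 - (c + 1) by omega))
    have h₇ : (((c + 1 + b : ℕ)) : ℚ) ≤ (((c + 1) ^ 2 * (e + 2) : ℕ) : ℚ) := by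
      push_cast at h₄ ⊢
      linarith
    exact_mod_cast h₇

/-- `IsTail t q` says that the `d`-values `t` along a path are realised by positive `r`-values whose
first quotient `r₁ / r₀` is `q`. -/
def IsTail : List ℕ → ℚ → Prop
  | [], q => q = 0
  | c :: t, q => 0 < q ∧ IsTail t (c - q⁻¹)

theorem IsTail.nonneg {t : List ℕ} {q : ℚ} (h : IsTail t q) : 0 ≤ q := by
  cases t with
  | nil => exact h.ge
  | cons c t => exact h.1.le

theorem IsTail.pos {t : List ℕ} {q : ℚ} (h : IsTail t q) : ∀ c ∈ t, 0 < c := by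
  induction t generalizing q with
  | nil => simp
  | cons c t ih =>
    have h₁ := h.2.nonneg
    have h₂ := inv_pos.2 h.1
    have h₃ : (0 : ℚ) < c := by linarith
    intro e he
    rcases List.mem_cons.1 he with rfl | he
    · exact_mod_cast h₃
    · exact ih h.2 e he

theorem IsTail.unique {t : List ℕ} {q q' : ℚ} (h : IsTail t q) (h' : IsTail t q') : q = q' := by
  induction t generalizing q q' with
  | nil => exact h.trans h'.symm
  | cons c t ih =>
    have := ih h.2 h'.2
    exact inv_injective (by linarith)

/-- The tails of length `ℓ` whose value lies in a given class modulo `1`. -/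
def tails (α : ℚ) (ℓ : ℕ) : Set (List ℕ) :=
  {t | t.length = ℓ ∧ ∃ j : ℤ, IsTail t (α + j)}

theorem exists_rep (α : ℚ) : ∃ q : ℚ, 0 < q ∧ q ≤ 1 ∧ ∃ j : ℤ, q = α + j := by
  refine ⟨α + (1 - ⌈α⌉ : ℤ), ?_, ?_, _, rfl⟩ <;> push_cast
  · linarith [Int.ceil_lt_add_one α]
  · linarith [Int.le_ceil α]

theorem mem_tails_succ {α q : ℚ} {j : ℤ} (hq : 0 < q) (hq₁ : q ≤ 1) (h : q = α + j) {ℓ : ℕ}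
    {c : ℕ} {t : List ℕ} : c :: t ∈ tails α (ℓ + 1) ↔
      t.length = ℓ ∧ ∃ k : ℕ, IsTail t (c - (q + k)⁻¹) := by
  constructor
  · rintro ⟨hl, i, hi, ht⟩
    refine ⟨by simpa using hl, (i - j).toNat, ?_⟩
    have h₁ : (-1 : ℚ) < ((i - j : ℤ) : ℚ) := by push_cast; linarith
    have h₂ : 0 ≤ i - j := by
      have : -1 < i - j := by exact_mod_cast h₁
      omega
    have h₃ : (((i - j).toNat : ℕ) : ℚ) = i - j := by
      rw [← Int.cast_natCast, Int.toNat_of_nonneg h₂]; push_cast; rfl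
    rw [h₃, h, show α + j + (i - j) = α + i by ring]
    exact ht
  · rintro ⟨hl, k, hk⟩
    refine ⟨by simpa using hl, j + k, ?_⟩
    rw [show α + ((j + k : ℤ) : ℚ) = q + k by rw [h]; push_cast; ring]
    exact ⟨by positivity, hk⟩

/-- The tails of length `ℓ` in the class of `α` are counted by a ballot number. -/
theorem exists_finset_tails (ℓ : ℕ) : ∀ α : ℚ, ∃ F : Finset (List ℕ),
    (∀ t, t ∈ F ↔ t ∈ tails α ℓ) ∧ F.card = ballot ℓ (hjLength α) := by
  classical
  induction ℓ with
  | zero =>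
    intro α
    by_cases h : Int.fract α = 0
    · refine ⟨{[]}, fun t => ?_, by simp [hjLength_of_fract_eq_zero h, ballot]⟩
      rw [Finset.mem_singleton]
      constructor
      · rintro rfl
        refine ⟨rfl, -⌊α⌋, ?_⟩
        rw [Int.cast_neg, ← sub_eq_add_neg]
        exact h
      · exact fun ht => List.length_eq_zero_iff.1 ht.1
    · refine ⟨∅, fun t => ?_, by simp [hjLength_of_fract_ne_zero h, ballot]⟩
      refine iff_of_false (Finset.notMem_empty t) ?_
      rintro ⟨ht, j, hj⟩
      rw [List.length_eq_zero_iff] at ht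
      subst ht
      have hj : α + j = 0 := hj
      apply h
      rw [← Int.fract_add_intCast α j, hj, Int.fract_zero]
  | succ ℓ ih =>
    intro α
    obtain ⟨q, hq, hq₁, j, h⟩ := exists_rep α
    choose F hF hcard using ih
    have hlen (k : ℕ) : hjLength (-(q + k)⁻¹) = hjLength α - 1 + k := by
      rw [hjLength_neg_inv_add_natCast hq, hjLength_neg_inv hq hq₁ h]
    have hval (k : ℕ) (t : List ℕ) (ht : t ∈ F (-(q + k)⁻¹)) :
        ∃ c : ℕ, IsTail t (c - (q + k)⁻¹) := by
      obtain ⟨-, i, hi⟩ := (hF _ t).1 ht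
      have h₁ := hi.nonneg
      have h₂ : 0 < (q + k)⁻¹ := by positivity
      have h₃ : (0 : ℚ) ≤ i := by linarith
      lift i to ℕ using by exact_mod_cast h₃
      refine ⟨i, ?_⟩
      rwa [Int.cast_natCast, neg_add_eq_sub] at hi
    choose! c hc using hval
    have hinv (k k' : ℕ) (t : List ℕ) (e : ℕ) (h₁ : IsTail t (e - (q + k)⁻¹))
        (h₂ : IsTail t (e - (q + k')⁻¹)) : k = k' := by
      have h₃ : q + k = q + k' := inv_injective (by linarith [h₁.unique h₂])
      exact_mod_cast add_left_cancel h₃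
    refine ⟨(Finset.range (ℓ + 1 - (hjLength α - 1))).biUnion fun k =>
      (F (-(q + k)⁻¹)).image fun t => c k t :: t, fun s => ?_, ?_⟩
    · cases s with
      | nil => simp [tails]
      | cons e t =>
        rw [mem_tails_succ hq hq₁ h]
        simp only [Finset.mem_biUnion, Finset.mem_range, Finset.mem_image, List.cons.injEq]
        constructor
        · rintro ⟨k, -, t, ht, rfl, rfl⟩
          exact ⟨((hF _ _).1 ht).1, k, hc k t ht⟩
        · rintro ⟨hl, k, hk⟩
          have ht : t ∈ F (-(q + k)⁻¹) := by
            refine (hF _ _).2 ⟨hl, e, ?_⟩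
            rwa [Int.cast_natCast, neg_add_eq_sub]
          refine ⟨k, ?_, t, ht, ?_, rfl⟩
          · by_contra hk'
            have h₀ : (F (-(q + k)⁻¹)).card = 0 := by
              rw [hcard, hlen, ballot_eq_zero (by omega)]
            rw [Finset.card_eq_zero.1 h₀] at ht
            exact Finset.notMem_empty t ht
          · have := (hc k t ht).unique hk
            exact_mod_cast sub_left_injective this
    · rw [Finset.card_biUnion, ballot]
      · refine Finset.sum_congr rfl fun k _ => ?_
        rw [Finset.card_image_of_injective _ fun t t' ht => (List.cons.inj ht).2, hcard, hlen]
      · intro k _ k' _ hkk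
        rw [Function.onFun, Finset.disjoint_left]
        intro s hs hs'
        obtain ⟨t, ht, rfl⟩ := Finset.mem_image.1 hs
        obtain ⟨t', ht', he⟩ := Finset.mem_image.1 hs'
        obtain ⟨h₁, rfl⟩ := List.cons.inj he
        refine hkk (hinv k k' t' _ (hc k t' ht) ?_)
        rw [← h₁]
        exact hc k' t' ht'

theorem isTail_map_range (ℓ : ℕ) : ∀ d r : ℕ → ℕ, (∀ i ≤ ℓ, 0 < r i) → r (ℓ + 1) = 0 →
    (∀ i < ℓ, d (i + 1) * r (i + 1) = r i + r (i + 2)) →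
    IsTail ((List.range ℓ).map fun i => d (i + 1)) (r 1 / r 0) := by
  induction ℓ with
  | zero =>
    intro d r _ h _
    simp only [zero_add] at h
    simp [IsTail, h]
  | succ ℓ ih =>
    intro d r hr hz he
    have h₀ : (0 : ℚ) < r 0 := by exact_mod_cast hr 0 (by omega)
    have h₁ : (0 : ℚ) < r 1 := by exact_mod_cast hr 1 (by omega)
    have h := ih (fun i => d (i + 1)) (fun i => r (i + 1)) (fun i hi => hr _ (by omega)) hz
      fun i hi => he (i + 1) (by omega)
    rw [List.range_succ_eq_map, List.map_cons, List.map_map]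
    refine ⟨by positivity, ?_⟩
    have he₀ : (d 1 * r 1 : ℚ) = r 0 + r 2 := by exact_mod_cast he 0 (by omega)
    have hq : (d (0 + 1) : ℚ) - (r 1 / r 0 : ℚ)⁻¹ = r (1 + 1) / r (0 + 1) := by
      rw [zero_add, one_add_one_eq_two]
      field_simp
      linarith
    rw [hq]
    exact h

theorem IsTail.exists_path {t : List ℕ} {q : ℚ} (h : IsTail t q) : ∃ r : ℕ → ℕ,
    (∀ i ≤ t.length, 0 < r i) ∧ (∀ i, t.length < i → r i = 0) ∧
    (∀ i < t.length, t.getD i 0 * r (i + 1) = r i + r (i + 2)) ∧ (r 1 : ℚ) = q * r 0 := by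
  induction t generalizing q with
  | nil =>
    refine ⟨fun i => if i = 0 then 1 else 0, by simp, fun i hi => ?_, by simp, ?_⟩
    · exact if_neg (by simpa using Nat.ne_of_gt hi)
    · simpa using h.symm
  | cons c t ih =>
    obtain ⟨hq, ht⟩ := h
    obtain ⟨r, hpos, hz, he, h₁⟩ := ih ht
    lift q to ℚ≥0 using hq.le
    have hq' : (0 : ℚ≥0) < q := by exact_mod_cast hq
    have hnum := NNRat.num_pos.2 hq'
    have hden := q.den_pos
    refine ⟨fun i => Nat.casesOn i (q.den * r 0) fun i => q.num * r i, ?_, ?_, ?_, ?_⟩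
    · rintro (_ | i) hi
      · exact Nat.mul_pos hden (hpos 0 (Nat.zero_le _))
      · exact Nat.mul_pos hnum (hpos i (by simpa using hi))
    · rintro (_ | i) hi
      · simp at hi
      · have : r i = 0 := hz i (by simpa using hi)
        simp [this]
    · rintro (_ | i) hi
      · have hqe : (q : ℚ) * q.den = q.num := by exact_mod_cast NNRat.mul_den_eq_num q
        have : ((c * (q.num * r 0) : ℕ) : ℚ) = ((q.den * r 0 + q.num * r 1 : ℕ) : ℚ) := by
          push_cast
          rw [h₁, ← hqe]
          field_simp
          ring
        exact_mod_cast this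
      · have := he i (by simpa using hi)
        simp only [List.getD_cons_succ]
        calc _ = q.num * (t.getD i 0 * r (i + 1)) := by ring
          _ = _ := by rw [this]; ring
    · have hqe : (q : ℚ) * q.den = q.num := by exact_mod_cast NNRat.mul_den_eq_num q
      change ((q.num * r 0 : ℕ) : ℚ) = q * ((q.den * r 0 : ℕ) : ℚ)
      push_cast
      rw [← hqe]
      ring

/-- The data `(dx, dy, (d₁, …, d_ℓ))` from which an arithmetical structure can be recovered. -/
def codes (ℓ : ℕ) : Set ((ℕ × ℕ) × List ℕ) :=
  {x | (0 < x.1.1 ∧ 0 < x.1.2) ∧ x.2 ∈ tails (prong x.1.1 x.1.2) ℓ}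

namespace ArithOn

variable {n : ℕ}

theorem path_eq (s : ArithOn n) : ∀ i < n - 3, s.d (i + 1) * s.r (i + 1) = s.r i + s.r (i + 2) := by
  obtain ⟨-, -, -, -, -, -, -, -, -, -, -, he, hl, -⟩ := s.arith
  intro i hi
  rcases Nat.lt_or_ge (i + 1) (n - 3) with h | h
  · exact he (i + 1) (by omega) h
  · have h' : n - 3 = i + 1 := by omega
    have := hl (by omega)
    rw [h'] at this
    rw [this, s.r_pad (i + 2) (by omega)]
    rfl

theorem isTail (s : ArithOn n) : IsTail ((List.range (n - 3)).map fun i => s.d (i + 1))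
    (s.r 1 / s.r 0) := by
  obtain ⟨-, -, -, -, -, -, hr, -⟩ := s.arith
  exact isTail_map_range _ _ _ hr (s.r_pad _ (Nat.lt_succ_self _)) s.path_eq

theorem quotient_eq (hn : 4 ≤ n) (s : ArithOn n) :
    (s.r 1 / s.r 0 : ℚ) = prong s.dx s.dy + (s.d 0 : ℤ) := by
  obtain ⟨-, hdx, hdy, -, hx, hy, hr, ex, ey, e₀, -⟩ := s.arith
  have hx' : (0 : ℚ) < s.rx := by exact_mod_cast hx
  have hy' : (0 : ℚ) < s.ry := by exact_mod_cast hy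
  have hr' : (0 : ℚ) < s.r 0 := by exact_mod_cast hr 0 (Nat.zero_le _)
  have hdx' : (0 : ℚ) < s.dx := by exact_mod_cast hdx
  have hdy' : (0 : ℚ) < s.dy := by exact_mod_cast hdy
  have ex' : (s.rx : ℚ) = s.r 0 * (s.dx : ℚ)⁻¹ := by
    rw [← ex]; push_cast; field_simp
  have ey' : (s.ry : ℚ) = s.r 0 * (s.dy : ℚ)⁻¹ := by
    rw [← ey]; push_cast; field_simp
  have e₀' : (s.d 0 * s.r 0 : ℚ) = s.rx + s.ry + s.r 1 := by exact_mod_cast e₀ (by omega)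
  rw [prong, Int.cast_natCast, div_eq_iff hr'.ne']
  linarith

/-- The code of an arithmetical structure. -/
def code (s : ArithOn n) : (ℕ × ℕ) × List ℕ :=
  ((s.dx, s.dy), (List.range (n - 3)).map fun i => s.d (i + 1))

theorem code_mem (hn : 4 ≤ n) (s : ArithOn n) : s.code ∈ codes (n - 3) := by
  refine ⟨⟨s.arith.2.1, s.arith.2.2.1⟩, by simp [code], s.d 0, ?_⟩
  have h := s.isTail
  rwa [s.quotient_eq hn] at h

theorem r_zero_dvd {s s' : ArithOn n} (hx : s.rx * s'.r 0 = s'.rx * s.r 0)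
    (hy : s.ry * s'.r 0 = s'.ry * s.r 0) (hr : ∀ i, s.r i * s'.r 0 = s'.r i * s.r 0) :
    s.r 0 ∣ s'.r 0 := by
  obtain ⟨-, -, -, -, -, -, hpos, -, -, -, -, -, -, hprim⟩ := s.arith
  have hg : 0 < Nat.gcd (s.r 0) (s'.r 0) := Nat.gcd_pos_of_pos_left _ (hpos 0 (Nat.zero_le _))
  obtain ⟨u, v, huv, hu, hv⟩ := Nat.exists_coprime (s.r 0) (s'.r 0)
  have key : ∀ x x', x * s'.r 0 = x' * s.r 0 → u ∣ x := by
    intro x x' h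
    refine huv.dvd_of_dvd_mul_right ⟨x', Nat.eq_of_mul_eq_mul_right hg ?_⟩
    rw [mul_assoc, ← hv, h, mul_comm u, mul_assoc, ← hu]
  have h₁ : u = 1 := hprim u (key _ _ hx) (key _ _ hy) fun i _ => key _ _ (hr i)
  rw [h₁, one_mul] at hu
  rw [hu]
  exact Nat.gcd_dvd_right _ _

theorem code_injective (hn : 4 ≤ n) : Function.Injective (code : ArithOn n → _) := by
  intro s s' h
  have hdx : s.dx = s'.dx := congrArg (·.1.1) h
  have hdy : s.dy = s'.dy := congrArg (·.1.2) h
  have ht : ((List.range (n - 3)).map fun i => s.d (i + 1)) =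
    (List.range (n - 3)).map fun i => s'.d (i + 1) := congrArg (·.2) h
  have hq : (s.r 1 / s.r 0 : ℚ) = s'.r 1 / s'.r 0 := s.isTail.unique (ht ▸ s'.isTail)
  have hd : s.d = s'.d := by
    funext i
    rcases i with _ | i
    · rw [s.quotient_eq hn, s'.quotient_eq hn, hdx, hdy] at hq
      exact_mod_cast add_left_cancel hq
    · rcases Nat.lt_or_ge i (n - 3) with hi | hi
      · exact List.map_inj_left.1 ht i (List.mem_range.2 hi)
      · rw [s.d_pad _ (by omega), s'.d_pad _ (by omega)]
  have hp := s.path_eq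
  have hp' := s'.path_eq
  obtain ⟨-, hdx₀, hdy₀, -, -, -, hpos, ex, ey, -⟩ := s.arith
  obtain ⟨-, -, -, -, -, -, hpos', ex', ey', -⟩ := s'.arith
  have hr : ∀ i, s.r i * s'.r 0 = s'.r i * s.r 0 := by
    intro i
    induction i using Nat.strong_induction_on with
    | _ i ih =>
      rcases i with _ | _ | i
      · exact mul_comm _ _
      · have h₀ : (s.r 0 : ℚ) ≠ 0 := by exact_mod_cast (hpos 0 (Nat.zero_le _)).ne'
        have h₀' : (s'.r 0 : ℚ) ≠ 0 := by exact_mod_cast (hpos' 0 (Nat.zero_le _)).ne'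
        rw [div_eq_div_iff h₀ h₀'] at hq
        exact_mod_cast hq
      · rcases Nat.lt_or_ge i (n - 3) with hi | hi
        · have h₁ := ih i (by omega)
          have h₂ := ih (i + 1) (by omega)
          have h₃ := hp i hi
          have h₄ := hp' i hi
          rw [← hd] at h₄
          zify at h₁ h₂ h₃ h₄ ⊢
          linear_combination (-(s'.r 0 : ℤ)) * h₃ + (s.r 0 : ℤ) * h₄ + (s.d (i + 1) : ℤ) * h₂ - h₁
        · have hi' : n - 3 < i + 1 + 1 := by omega
          rw [s.r_pad _ hi', s'.r_pad _ hi', zero_mul, zero_mul]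
  have hx : s.rx * s'.r 0 = s'.rx * s.r 0 := by rw [← ex, ← ex', hdx]; ring
  have hy : s.ry * s'.r 0 = s'.ry * s.r 0 := by rw [← ey, ← ey', hdy]; ring
  have h₀ : s.r 0 = s'.r 0 :=
    Nat.dvd_antisymm (r_zero_dvd hx hy hr) (r_zero_dvd hx.symm hy.symm fun i => (hr i).symm)
  have hpos₀ := hpos' 0 (Nat.zero_le _)
  rw [h₀] at hx hy hr
  have hx' := Nat.eq_of_mul_eq_mul_right hpos₀ hx
  have hy' := Nat.eq_of_mul_eq_mul_right hpos₀ hy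
  have hr' : s.r = s'.r := funext fun i => Nat.eq_of_mul_eq_mul_right hpos₀ (hr i)
  cases s
  cases s'
  simp_all

theorem exists_primitive {ℓ dx dy : ℕ} {d : ℕ → ℕ} {rx ry : ℕ} {r : ℕ → ℕ} (hℓ : 1 ≤ ℓ)
    (hdx : 0 < dx) (hdy : 0 < dy) (hd : ∀ i ≤ ℓ, 0 < d i) (hx : 0 < rx) (hy : 0 < ry)
    (hr : ∀ i ≤ ℓ, 0 < r i) (hz : ∀ i, ℓ < i → r i = 0) (ex : dx * rx = r 0) (ey : dy * ry = r 0)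
    (e₀ : d 0 * r 0 = rx + ry + r 1) (he : ∀ i < ℓ, d (i + 1) * r (i + 1) = r i + r (i + 2)) :
    ∃ rx' ry' r', IsArith (ℓ + 3) dx dy d rx' ry' r' ∧ ∀ i, ℓ < i → r' i = 0 := by
  set g := Nat.gcd rx (Nat.gcd ry ((Finset.range (ℓ + 1)).gcd r)) with hg
  have hg₀ : 0 < g := Nat.gcd_pos_of_pos_left _ hx
  have gx : g ∣ rx := Nat.gcd_dvd_left _ _
  have gy : g ∣ ry := (Nat.gcd_dvd_right _ _).trans (Nat.gcd_dvd_left _ _)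
  have gr : ∀ i, g ∣ r i := by
    intro i
    rcases Nat.lt_or_ge ℓ i with hi | hi
    · rw [hz i hi]; exact dvd_zero g
    · exact ((Nat.gcd_dvd_right _ _).trans (Nat.gcd_dvd_right _ _)).trans
        (Finset.gcd_dvd (Finset.mem_range.2 (by omega)))
  obtain ⟨x, hx'⟩ := gx
  obtain ⟨y, hy'⟩ := gy
  choose r' hr' using gr
  have pos_of {a b : ℕ} (h : a = g * b) (ha : 0 < a) : 0 < b :=
    Nat.pos_of_mul_pos_left (h ▸ ha)
  have cancel {a b : ℕ} (h : g * a = g * b) : a = b := Nat.eq_of_mul_eq_mul_left hg₀ h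
  have eq' : ∀ i < ℓ, d (i + 1) * r' (i + 1) = r' i + r' (i + 2) := by
    intro i hi
    have := he i hi
    rw [hr' i, hr' (i + 1), hr' (i + 2)] at this
    exact cancel (by linarith)
  have hz' : ∀ i, ℓ < i → r' i = 0 := by
    intro i hi
    have := hz i hi
    rw [hr' i] at this
    exact (Nat.mul_eq_zero.1 this).resolve_left hg₀.ne'
  refine ⟨x, y, r', ⟨by omega, hdx, hdy, hd, pos_of hx' hx, pos_of hy' hy,
    fun i hi => pos_of (hr' i) (hr i hi), ?_, ?_, fun _ => ?_, ?_, ?_, fun _ => ?_, ?_⟩, hz'⟩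
  · rw [hx', hr' 0] at ex
    exact cancel (by linarith)
  · rw [hy', hr' 0] at ey
    exact cancel (by linarith)
  · rw [hx', hy', hr' 0, hr' 1] at e₀
    exact cancel (by linarith)
  · omega
  · intro i h₁ h₂
    obtain ⟨i, rfl⟩ := Nat.exists_eq_add_of_le' h₁
    exact eq' i (by omega)
  · obtain ⟨k, rfl⟩ := Nat.exists_eq_add_of_le' hℓ
    have h := eq' k (by omega)
    rw [hz' (k + 2) (by omega)] at h
    exact h
  · intro c cx cy cr
    have h : g * c ∣ g := by
      conv_rhs => rw [hg]
      refine Nat.dvd_gcd ?_ (Nat.dvd_gcd ?_ (Finset.dvd_gcd fun i hi => ?_))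
      · rw [hx']; exact mul_dvd_mul_left g cx
      · rw [hy']; exact mul_dvd_mul_left g cy
      · rw [hr' i]; exact mul_dvd_mul_left g (cr i (by have := Finset.mem_range.1 hi; omega))
    exact Nat.dvd_one.1 ((Nat.mul_dvd_mul_iff_left hg₀).1 (by simpa using h))

theorem code_surjective (hn : 4 ≤ n) {x : (ℕ × ℕ) × List ℕ} (hx : x ∈ codes (n - 3)) :
    ∃ s : ArithOn n, s.code = x := by
  obtain ⟨⟨a, b⟩, t⟩ := x
  obtain ⟨⟨ha, hb⟩, hl, j, hj⟩ := hx
  simp only at ha hb hl hj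
  obtain ⟨r, hr, hz, he, h₁⟩ := hj.exists_path
  have ha' : (0 : ℚ) < a := by exact_mod_cast ha
  have hb' : (0 : ℚ) < b := by exact_mod_cast hb
  have hj₀ : 0 < j := by
    have h₂ := hj.nonneg
    have h₃ := inv_pos.2 ha'
    have h₄ := inv_pos.2 hb'
    rw [prong] at h₂
    have : (0 : ℚ) < j := by linarith
    exact_mod_cast this
  lift j to ℕ using hj₀.le
  have hd : ∀ i ≤ n - 3, 0 < (j :: t).getD i 0 := by
    rintro (_ | i) hi
    · exact_mod_cast hj₀
    · rw [List.getD_cons_succ, List.getD_eq_getElem _ _ (by omega)]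
      exact hj.pos _ (List.getElem_mem _)
  rw [hl] at hr hz he
  have hr₀ := hr 0 (Nat.zero_le _)
  have e₀ : j * (a * b * r 0) = b * r 0 + a * r 0 + a * b * r 1 := by
    have : ((j * (a * b * r 0) : ℕ) : ℚ) = ((b * r 0 + a * r 0 + a * b * r 1 : ℕ) : ℚ) := by
      push_cast
      rw [h₁, prong]
      push_cast
      field_simp
      ring
    exact_mod_cast this
  have e : ∀ i < n - 3, t.getD i 0 * (a * b * r (i + 1)) = a * b * r i + a * b * r (i + 2) := by
    intro i hi
    rw [← mul_add, ← he i hi]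
    ring
  obtain ⟨rx, ry, r', harith, hpad⟩ := exists_primitive (ℓ := n - 3) (dx := a) (dy := b)
    (d := fun i => (j :: t).getD i 0) (rx := b * r 0) (ry := a * r 0)
    (r := fun i => a * b * r i) (by omega) ha hb hd (by positivity) (by positivity)
    (fun i hi => Nat.mul_pos (Nat.mul_pos ha hb) (hr i hi)) (fun i hi => by simp [hz i hi])
    (by ring) (by ring) e₀ e
  rw [show n - 3 + 3 = n by omega] at harith
  refine ⟨⟨a, b, _, rx, ry, r', harith, fun i hi => ?_, hpad⟩, ?_⟩
  · exact List.getD_eq_default _ _ (by simp; omega)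
  · simp only [code, Prod.mk.injEq, true_and, List.getD_cons_succ]
    refine List.ext_getElem (by simp [hl]) fun i h₂ h₃ => ?_
    rw [List.getElem_map, List.getElem_range, List.getD_eq_getElem _ _ h₃]

theorem card_eq (hn : 4 ≤ n) : Nat.card (ArithOn n) = Nat.card (codes (n - 3)) :=
  Nat.card_congr <| Equiv.ofBijective (fun s => ⟨s.code, s.code_mem hn⟩)
    ⟨fun _ _ h => code_injective hn (congrArg Subtype.val h), fun x =>
      let ⟨s, hs⟩ := code_surjective hn x.2
      ⟨s, Subtype.ext hs⟩⟩

end ArithOn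

/-- Pairs `(a, b)` with `a ≤ m + 1` and `b` bounded in terms of `a`. -/
def smallPairs (m : ℕ) : Finset (ℕ × ℕ) :=
  (Finset.range (m + 1)).biUnion fun a =>
    (Finset.range ((a + 1) ^ 2 * (m + 2 - a))).image fun b => (a + 1, b + 1)

/-- Pairs `(m + 1 + c, m + 1 + e)` with `1 ≤ c ≤ m + 1` and `1 ≤ e ≤ (m + 1) ^ 2`. -/
def largePairs (m : ℕ) : Finset (ℕ × ℕ) :=
  (Finset.range (m + 1) ×ˢ Finset.range ((m + 1) ^ 2)).image fun p =>
    (m + 2 + p.1, m + 2 + p.2)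

/-- A finite set containing every pair of prong values whose continued fraction has length at most
`m`. -/
def coverPairs (m : ℕ) : Finset (ℕ × ℕ) :=
  (smallPairs m ∪ largePairs m) ∪ (smallPairs m ∪ largePairs m).image Prod.swap

theorem mem_smallPairs {a b m : ℕ} (ha : 0 < a) (hb : 0 < b) (hm : hjLength (prong a b) ≤ m)
    (h : a ≤ m + 1) : (a, b) ∈ smallPairs m := by
  have h' := add_le_of_hjLength_prong ha hb hm h
  simp only [smallPairs, Finset.mem_biUnion, Finset.mem_range, Finset.mem_image]
  refine ⟨a - 1, by omega, b - 1, ?_, by ext <;> simp <;> omega⟩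
  rw [Nat.sub_add_cancel ha, show m + 2 - (a - 1) = m + 3 - a by omega]
  omega

theorem mem_largePairs {a b m : ℕ} (ha : m + 1 < a) (hb : m + 1 < b)
    (h : (a - (m + 1)) * (b - (m + 1)) ≤ (m + 1) ^ 2) (h' : a - (m + 1) ≤ m + 1) :
    (a, b) ∈ largePairs m := by
  obtain ⟨c, rfl⟩ := Nat.exists_eq_add_of_lt ha
  obtain ⟨e, rfl⟩ := Nat.exists_eq_add_of_lt hb
  rw [show m + 1 + c + 1 - (m + 1) = c + 1 by omega] at h h'
  rw [show m + 1 + e + 1 - (m + 1) = e + 1 by omega] at h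
  have he : e + 1 ≤ (c + 1) * (e + 1) := Nat.le_mul_of_pos_left _ (Nat.succ_pos c)
  refine Finset.mem_image.2 ⟨(c, e), ?_, by ext <;> simp <;> omega⟩
  rw [Finset.mem_product, Finset.mem_range, Finset.mem_range]
  exact ⟨h', he.trans h⟩

theorem mem_coverPairs {a b m : ℕ} (ha : 0 < a) (hb : 0 < b) (hm : hjLength (prong a b) ≤ m) :
    (a, b) ∈ coverPairs m := by
  have hm' : hjLength (prong b a) ≤ m := by rwa [prong_comm]
  have hswap (h : (b, a) ∈ smallPairs m ∪ largePairs m) : (a, b) ∈ coverPairs m :=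
    Finset.mem_union_right _ (Finset.mem_image.2 ⟨_, h, rfl⟩)
  rcases Nat.lt_or_ge (m + 1) a with h₁ | h₁
  · rcases Nat.lt_or_ge (m + 1) b with h₂ | h₂
    · have h := mul_le_of_hjLength_prong ha hb hm
      have key : (a - (m + 1)) * (b - (m + 1)) ≤ (m + 1) ^ 2 := by
        zify [h₁.le, h₂.le] at h ⊢
        linarith
      rcases Nat.lt_or_ge (m + 1) (a - (m + 1)) with h₃ | h₃
      · refine hswap (Finset.mem_union_right _ (mem_largePairs h₂ h₁ (by rwa [mul_comm]) ?_))
        by_contra! h₄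
        exact absurd key (by rw [sq]; exact not_le.2 (Nat.mul_lt_mul'' h₃ h₄))
      · exact Finset.mem_union_left _ (Finset.mem_union_right _ (mem_largePairs h₁ h₂ key h₃))
    · exact hswap (Finset.mem_union_left _ (mem_smallPairs hb ha hm' h₂))
  · exact Finset.mem_union_left _ (Finset.mem_union_left _ (mem_smallPairs ha hb hm h₁))

/-- An upper bound for the number of pairs of prong values with continued fraction length at most
`m`. -/
def pairBound (m : ℚ) : ℚ :=
  (m + 1) * (m + 2) * (2 * m + 3) * (m + 3) / 3 - (m + 1) ^ 2 * (m + 2) ^ 2 / 2 + 2 * (m + 1) ^ 3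

theorem sum_sq_mul_sub (x : ℚ) (k : ℕ) : ∑ a ∈ Finset.range k, ((a : ℚ) + 1) ^ 2 * (x - a) =
    (x + 1) * (k * (k + 1) * (2 * k + 1) / 6) - k ^ 2 * (k + 1) ^ 2 / 4 := by
  induction k with
  | zero => simp
  | succ k ih =>
    rw [Finset.sum_range_succ, ih]
    push_cast
    ring

theorem card_coverPairs_le (m : ℕ) : ((coverPairs m).card : ℚ) ≤ pairBound m := by
  have h₁ : (smallPairs m).card ≤ ∑ a ∈ Finset.range (m + 1), (a + 1) ^ 2 * (m + 2 - a) := by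
    refine Finset.card_biUnion_le.trans (Finset.sum_le_sum fun a _ => ?_)
    exact Finset.card_image_le.trans (Finset.card_range _).le
  have h₂ : (largePairs m).card ≤ (m + 1) ^ 3 := by
    refine Finset.card_image_le.trans ?_
    rw [Finset.card_product, Finset.card_range, Finset.card_range]
    exact (by ring : (m + 1) * (m + 1) ^ 2 = (m + 1) ^ 3).le
  have h₃ : (coverPairs m).card ≤ 2 * ((smallPairs m).card + (largePairs m).card) := by
    have h := Finset.card_union_le (smallPairs m) (largePairs m)
    have h' : ((smallPairs m ∪ largePairs m).image Prod.swap).card ≤ _ := Finset.card_image_le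
    have h'' : (coverPairs m).card ≤ _ := Finset.card_union_le _ _
    omega
  have h₄ : ((∑ a ∈ Finset.range (m + 1), (a + 1) ^ 2 * (m + 2 - a) : ℕ) : ℚ) =
      ∑ a ∈ Finset.range (m + 1), ((a : ℚ) + 1) ^ 2 * ((m + 2 : ℚ) - a) := by
    rw [Nat.cast_sum]
    refine Finset.sum_congr rfl fun a ha => ?_
    have : a ≤ m + 2 := by have := Finset.mem_range.1 ha; omega
    push_cast [Nat.cast_sub this]
    ring
  have h₅ : ((coverPairs m).card : ℚ) ≤
      2 * ((∑ a ∈ Finset.range (m + 1), (a + 1) ^ 2 * (m + 2 - a) : ℕ) + (m + 1) ^ 3) := by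
    exact_mod_cast h₃.trans (by gcongr)
  rw [h₄, sum_sq_mul_sub] at h₅
  refine h₅.trans (le_of_eq ?_)
  rw [pairBound]
  push_cast
  ring

theorem weight_eq_sum (N : ℕ) : ∀ k ≤ N, ((k : ℚ) + 1) / 2 ^ k =
    ∑ m ∈ Finset.range N, (if k ≤ m then (m : ℚ) / 2 ^ (m + 1) else 0) + (N + 1) / 2 ^ N := by
  induction N with
  | zero =>
    intro k hk
    rw [Nat.le_zero.1 hk]
    simp
  | succ N ih =>
    intro k hk
    rw [Finset.sum_range_succ]
    rcases Nat.lt_or_ge N k with h | h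
    · obtain rfl : k = N + 1 := by omega
      rw [Finset.sum_eq_zero fun m hm => if_neg (by have := Finset.mem_range.1 hm; omega),
        if_neg (by omega)]
      simp
    · rw [ih k h, if_pos h, add_assoc]
      congr 1
      push_cast
      field_simp
      ring

theorem sum_pairBound (N : ℕ) :
    ∑ m ∈ Finset.range (N + 1), (m : ℚ) / 2 ^ (m + 1) * pairBound m =
      608 - (602 + 401 * N + 358 / 3 * N ^ 2 + 17 * N ^ 3 + 2 / 3 * N ^ 4) / 2 ^ N
        - (N + 2) / 2 ^ (N + 1) * pairBound N := by
  induction N with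
  | zero => norm_num [pairBound]
  | succ N ih =>
    rw [Finset.sum_range_succ, ih, pairBound, pairBound]
    push_cast
    field_simp
    ring

theorem sum_weight_le {ι : Type*} (R : Finset ι) (f : ι → ℕ) (N : ℕ) (hf : ∀ p ∈ R, f p ≤ N)
    (hB : ∀ m : ℕ, ((R.filter fun p => f p ≤ m).card : ℚ) ≤ pairBound m) :
    ∑ p ∈ R, ((f p : ℚ) + 1) / 2 ^ f p ≤ 608 := by
  have h₁ : ∑ p ∈ R, ((f p : ℚ) + 1) / 2 ^ f p =
      ∑ m ∈ Finset.range (N + 1), (m : ℚ) / 2 ^ (m + 1) * (R.filter fun p => f p ≤ m).card +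
        (N + 2) / 2 ^ (N + 1) * R.card := by
    rw [Finset.sum_congr rfl fun p hp => weight_eq_sum (N + 1) (f p) ((hf p hp).trans N.le_succ),
      Finset.sum_add_distrib, Finset.sum_comm]
    congr 1
    · refine Finset.sum_congr rfl fun m _ => ?_
      rw [← Finset.sum_filter, Finset.sum_const, nsmul_eq_mul, mul_comm]
    · rw [Finset.sum_const, nsmul_eq_mul, mul_comm]
      push_cast
      ring
  have h₂ : (R.card : ℚ) ≤ pairBound N := by
    have h := hB N
    rwa [Finset.filter_true_of_mem hf] at h
  calc _ ≤ ∑ m ∈ Finset.range (N + 1), (m : ℚ) / 2 ^ (m + 1) * pairBound m +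
        (N + 2) / 2 ^ (N + 1) * pairBound N := by
        rw [h₁]
        gcongr with m
        exact hB m
    _ = 608 - (602 + 401 * N + 358 / 3 * N ^ 2 + 17 * N ^ 3 + 2 / 3 * N ^ 4) / 2 ^ N := by
        rw [sum_pairBound]; ring
    _ ≤ 608 := sub_le_self _ (by positivity)

/-- The pairs of prong values whose continued fraction has length at most `ℓ`. -/
noncomputable def prongPairs (ℓ : ℕ) : Finset (ℕ × ℕ) :=
  (coverPairs ℓ).filter fun p => 0 < p.1 ∧ 0 < p.2 ∧ hjLength (prong p.1 p.2) ≤ ℓ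

theorem mem_prongPairs {ℓ : ℕ} {p : ℕ × ℕ} :
    p ∈ prongPairs ℓ ↔ 0 < p.1 ∧ 0 < p.2 ∧ hjLength (prong p.1 p.2) ≤ ℓ := by
  rw [prongPairs, Finset.mem_filter]
  exact ⟨fun h => h.2, fun h => ⟨mem_coverPairs h.1 h.2.1 h.2.2, h⟩⟩

theorem card_codes (ℓ : ℕ) : Nat.card (codes ℓ) =
    ∑ p ∈ prongPairs ℓ, ballot ℓ (hjLength (prong p.1 p.2)) := by
  classical
  choose F hF hcard using exists_finset_tails ℓ
  have h : codes ℓ = ((prongPairs ℓ).biUnion fun p =>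
      (F (prong p.1 p.2)).image (Prod.mk p) : Finset ((ℕ × ℕ) × List ℕ)) := by
    ext ⟨p, t⟩
    simp only [codes, Set.mem_ofPred_eq, SetLike.mem_coe, Finset.mem_biUnion, Finset.mem_image,
      Prod.mk.injEq]
    constructor
    · rintro ⟨hp, ht⟩
      rw [← hF] at ht
      refine ⟨p, mem_prongPairs.2 ⟨hp.1, hp.2, ?_⟩, t, ht, rfl, rfl⟩
      by_contra! hlt
      have h₀ := hcard (prong p.1 p.2)
      rw [ballot_eq_zero hlt, Finset.card_eq_zero] at h₀
      rw [h₀] at ht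
      exact Finset.notMem_empty t ht
    · rintro ⟨p', hp', t', ht', rfl, rfl⟩
      have hp := mem_prongPairs.1 hp'
      exact ⟨⟨hp.1, hp.2.1⟩, (hF _ _).1 ht'⟩
  rw [h, Nat.card_coe_set_eq, Set.ncard_coe_finset, Finset.card_biUnion]
  · refine Finset.sum_congr rfl fun p _ => ?_
    rw [Finset.card_image_of_injective _ (Prod.mk_right_injective p), hcard]
  · intro p _ p' _ hpp
    rw [Function.onFun, Finset.disjoint_left]
    intro x hx hx'
    obtain ⟨t, -, rfl⟩ := Finset.mem_image.1 hx
    obtain ⟨t', -, he⟩ := Finset.mem_image.1 hx'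
    exact hpp (congrArg Prod.fst he).symm

/-- The pairs of prong values that are both at least two, apart from `(2, 2)`. -/
noncomputable def interiorPairs (ℓ : ℕ) : Finset (ℕ × ℕ) :=
  (prongPairs ℓ).filter fun p => p.1 ≠ 1 ∧ p.2 ≠ 1 ∧ p ≠ (2, 2)

theorem hjLength_prong_two_two : hjLength (prong 2 2) = 0 := by
  refine hjLength_of_fract_eq_zero ?_
  rw [show prong 2 2 = ((-1 : ℤ) : ℚ) by norm_num [prong], Int.fract_intCast]

theorem hjLength_prong_three_three : hjLength (prong 3 3) = 1 := by
  have h' := hjLength_neg_inv_add_natCast (show (0 : ℚ) < 1 / 2 by norm_num) 1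
  rw [prong_eq (by norm_num) (by norm_num)]
  norm_num at h' ⊢
  rw [h', show (-2 : ℚ) = ((-2 : ℤ) : ℚ) by norm_num,
    hjLength_of_fract_eq_zero (Int.fract_intCast _)]

theorem sum_prongPairs (ℓ : ℕ) :
    ∑ p ∈ prongPairs ℓ, ballot ℓ (hjLength (prong p.1 p.2)) = 2 * catalan (ℓ + 1) +
      ∑ p ∈ interiorPairs ℓ, ballot ℓ (hjLength (prong p.1 p.2)) := by
  set f : ℕ × ℕ → ℕ := fun p => ballot ℓ (hjLength (prong p.1 p.2)) with hf
  have hrow : prongPairs ℓ = (Finset.range (ℓ + 1)).image (fun k => (1, k + 1)) ∪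
      ((Finset.range ℓ).image (fun k => (k + 2, 1)) ∪ ({(2, 2)} ∪ interiorPairs ℓ)) := by
    ext ⟨a, b⟩
    simp only [interiorPairs, Finset.mem_union, Finset.mem_image, Finset.mem_range,
      Finset.mem_singleton, Finset.mem_filter, mem_prongPairs, Prod.mk.injEq]
    constructor
    · rintro ⟨ha, hb, h⟩
      by_cases ha₁ : a = 1
      · subst ha₁
        rw [hjLength_prong_one hb] at h
        exact Or.inl ⟨b - 1, by omega, rfl, by omega⟩
      by_cases hb₁ : b = 1
      · subst hb₁
        rw [prong_comm, hjLength_prong_one ha] at h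
        exact Or.inr (Or.inl ⟨a - 2, by omega, by omega, rfl⟩)
      by_cases h₂ : a = 2 ∧ b = 2
      · exact Or.inr (Or.inr (Or.inl h₂))
      · exact Or.inr (Or.inr (Or.inr ⟨⟨ha, hb, h⟩, ha₁, hb₁, by simpa using h₂⟩))
    · rintro (⟨k, hk, rfl, rfl⟩ | ⟨k, hk, rfl, rfl⟩ | ⟨rfl, rfl⟩ | ⟨h, -⟩)
      · refine ⟨one_pos, k.succ_pos, ?_⟩
        rw [hjLength_prong_one k.succ_pos]
        omega
      · refine ⟨by omega, one_pos, ?_⟩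
        rw [prong_comm, hjLength_prong_one (by omega)]
        omega
      · rw [hjLength_prong_two_two]
        omega
      · exact h
  have hd₁ : Disjoint ({(2, 2)} : Finset (ℕ × ℕ)) (interiorPairs ℓ) := by
    simp [interiorPairs]
  have hd₂ : Disjoint ((Finset.range ℓ).image (fun k => (k + 2, 1)))
      ({(2, 2)} ∪ interiorPairs ℓ) := by
    rw [Finset.disjoint_left]
    simp only [Finset.mem_image]
    rintro _ ⟨k, -, rfl⟩
    simp [interiorPairs]
  have hd₃ : Disjoint ((Finset.range (ℓ + 1)).image (fun k => (1, k + 1)))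
      ((Finset.range ℓ).image (fun k => (k + 2, 1)) ∪ ({(2, 2)} ∪ interiorPairs ℓ)) := by
    rw [Finset.disjoint_left]
    simp only [Finset.mem_image]
    rintro _ ⟨k, -, rfl⟩
    simp [interiorPairs]
  have h₁ : ∑ p ∈ (Finset.range (ℓ + 1)).image (fun k => (1, k + 1)), f p = catalan (ℓ + 1) := by
    rw [Finset.sum_image (by simp [Set.InjOn]), ← ballot_zero_right, ← sum_ballot]
    refine Finset.sum_congr rfl fun k _ => ?_
    simp only [hf]
    rw [hjLength_prong_one k.succ_pos, Nat.succ_sub_one]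
  have h₂ : ∑ p ∈ (Finset.range ℓ).image (fun k => (k + 2, 1)), f p + f (2, 2) =
      catalan (ℓ + 1) := by
    rw [Finset.sum_image (by simp [Set.InjOn]), ← ballot_zero_right, ← sum_ballot,
      Finset.sum_range_succ']
    congr 1
    · refine Finset.sum_congr rfl fun k _ => ?_
      simp only [hf]
      rw [prong_comm, hjLength_prong_one (by omega)]
      rfl
    · simp only [hf, hjLength_prong_two_two]
  rw [hrow, Finset.sum_union hd₃, Finset.sum_union hd₂, Finset.sum_union hd₁, h₁,
    Finset.sum_singleton, ← add_assoc, ← add_assoc, add_assoc (catalan (ℓ + 1)), h₂, two_mul]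

theorem catalan_le_sum_interiorPairs {ℓ : ℕ} (hℓ : 1 ≤ ℓ) :
    catalan ℓ ≤ ∑ p ∈ interiorPairs ℓ, ballot ℓ (hjLength (prong p.1 p.2)) := by
  have hmem : (3, 3) ∈ interiorPairs ℓ := by
    simpa [interiorPairs, mem_prongPairs, hjLength_prong_three_three] using hℓ
  refine le_trans (le_of_eq ?_) (Finset.single_le_sum (fun _ _ => Nat.zero_le _) hmem)
  obtain ⟨k, rfl⟩ := Nat.exists_eq_add_of_le' hℓ
  rw [hjLength_prong_three_three, ← ballot_succ_zero, ballot_zero_right]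

theorem sum_interiorPairs_lt (ℓ : ℕ) :
    ∑ p ∈ interiorPairs ℓ, ballot ℓ (hjLength (prong p.1 p.2)) < 702 * catalan ℓ := by
  have hmem : ∀ p ∈ interiorPairs ℓ, p ∈ prongPairs ℓ := fun p hp => (Finset.mem_filter.1 hp).1
  have h := sum_weight_le (interiorPairs ℓ) (fun p => hjLength (prong p.1 p.2)) ℓ
    (fun p hp => (mem_prongPairs.1 (hmem p hp)).2.2) fun m => by
      refine le_trans ?_ (card_coverPairs_le m)
      refine Nat.cast_le.2 (Finset.card_le_card fun p hp => ?_)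
      obtain ⟨hp, hm⟩ := Finset.mem_filter.1 hp
      have hp' := mem_prongPairs.1 (hmem p hp)
      exact mem_coverPairs hp'.1 hp'.2.1 hm
  have hc : (0 : ℚ) < catalan ℓ := by
    have h := succ_mul_catalan_eq_centralBinom ℓ
    have h' := Nat.centralBinom_pos ℓ
    rw [← h] at h'
    exact_mod_cast Nat.pos_of_mul_pos_left h'
  have key : ((∑ p ∈ interiorPairs ℓ, ballot ℓ (hjLength (prong p.1 p.2)) : ℕ) : ℚ) <
      ((702 * catalan ℓ : ℕ) : ℚ) := by
    calc _ ≤ ∑ p ∈ interiorPairs ℓ, (catalan ℓ : ℚ) *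
          ((hjLength (prong p.1 p.2) + 1) / 2 ^ hjLength (prong p.1 p.2)) := by
          rw [Nat.cast_sum]
          exact Finset.sum_le_sum fun p _ => ballot_le ℓ _
      _ ≤ catalan ℓ * 608 := by
          rw [← Finset.mul_sum]
          exact mul_le_mul_of_nonneg_left h hc.le
      _ < _ := by
          push_cast
          linarith
  exact_mod_cast key

/-- **Theorem 4.10.**  For `n ≥ 4`,
`2·C(n-2) + C(n-3) ≤ |Arith(D_n)| < 2·C(n-2) + 702·C(n-3)`,
where `C` denotes the Catalan numbers. -/
theorem arith_count_bounds (n : ℕ) (hn : 4 ≤ n) :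
    2 * catalan (n - 2) + catalan (n - 3) ≤ Nat.card (ArithOn n) ∧
    Nat.card (ArithOn n) < 2 * catalan (n - 2) + 702 * catalan (n - 3) := by
  obtain ⟨ℓ, rfl⟩ := Nat.exists_eq_add_of_le hn
  have h := ArithOn.card_eq hn
  rw [card_codes, sum_prongPairs, show 4 + ℓ - 3 = ℓ + 1 by omega] at h
  rw [h, show 4 + ℓ - 2 = ℓ + 1 + 1 by omega, show 4 + ℓ - 3 = ℓ + 1 by omega]
  exact ⟨Nat.add_le_add_left (catalan_le_sum_interiorPairs (by omega)) _,
    Nat.add_lt_add_left (sum_interiorPairs_lt _) _⟩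
end

section
/- Let n ≥ 3 and let (d, r) be an arithmetical structure on the bident D_n. Then the critical group K(D_n; d, r), i.e., the torsion subgroup of the cokernel ℤⁿ / Image(diag(d) − A), is a cyclic group. -/
/-- Adjacency of the bident, with vertex `0 = v_x`, vertex `1 = v_y`, and vertex
`i + 2 = v_i` for `0 ≤ i ≤ n - 3`:  `v_x` and `v_y` are each adjacent to `v_0`, and
consecutive path vertices are adjacent. -/
def bidentAdj (i j : ℕ) : Bool :=
  (i == 0 && j == 2) || (i == 2 && j == 0) || (i == 1 && j == 2) || (i == 2 && j == 1) ||
  (decide (2 ≤ i) && j == i + 1) || (decide (2 ≤ j) && i == j + 1)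

/-- The generalized Laplacian `L(D_n, d) = diag(d) - A` of the bident `D_n`, where `A` is the
adjacency matrix of `D_n` (vertex `0 = v_x`, vertex `1 = v_y`, vertex `i + 2 = v_i`). -/
def bidentLap (n dx dy : ℕ) (d : ℕ → ℕ) : Matrix (Fin n) (Fin n) ℤ :=
  Matrix.diagonal (fun i : Fin n =>
      if (i : ℕ) = 0 then (dx : ℤ) else if (i : ℕ) = 1 then (dy : ℤ) else (d ((i : ℕ) - 2) : ℤ))
    - Matrix.of (fun i j : Fin n => if bidentAdj (i : ℕ) (j : ℕ) then (1 : ℤ) else 0)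

/-- The critical group `K(D_n; d, r)`: the torsion subgroup of the cokernel
`ℤ^n / Image(L(D_n, d))`. -/
def critGroup (n dx dy : ℕ) (d : ℕ → ℕ) :
    Submodule ℤ ((Fin n → ℤ) ⧸ LinearMap.range (Matrix.toLin' (bidentLap n dx dy d))) :=
  Submodule.torsion ℤ ((Fin n → ℤ) ⧸ LinearMap.range (Matrix.toLin' (bidentLap n dx dy d)))

/-- The `k`-th standard basis vector of `ℤ^n`, with the convention that it is `0` for `n ≤ k`. -/
def bidentBasis (n k : ℕ) : Fin n → ℤ := fun i => if (i : ℕ) = k then 1 else 0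

lemma bidentBasis_eq_single {n : ℕ} (j : Fin n) : bidentBasis n j = Pi.single j 1 := by
  ext i
  simp [bidentBasis, Pi.single_apply, Fin.ext_iff]

lemma bidentBasis_of_le {n k : ℕ} (h : n ≤ k) : bidentBasis n k = 0 := by
  ext i
  have := i.isLt
  simp only [bidentBasis, Pi.zero_apply, ite_eq_right_iff]
  omega

lemma toLin'_bidentLap_apply (n dx dy : ℕ) (d : ℕ → ℕ) (j : Fin n) (i : Fin n) :
    Matrix.toLin' (bidentLap n dx dy d) (bidentBasis n j) i =
      (if (i : ℕ) = j then
        (if (j : ℕ) = 0 then (dx : ℤ) else if (j : ℕ) = 1 then (dy : ℤ) else (d (j - 2) : ℤ))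
        else 0) - if bidentAdj i j then 1 else 0 := by
  rw [bidentBasis_eq_single, Matrix.toLin'_apply, Matrix.mulVec_single_one]
  simp only [bidentLap, Matrix.col_apply, Matrix.sub_apply, Matrix.of_apply,
    Matrix.diagonal_apply, Fin.ext_iff]
  split_ifs <;> simp_all

lemma toLin'_bidentLap_zero {n : ℕ} (hn : 3 ≤ n) (dx dy : ℕ) (d : ℕ → ℕ) :
    Matrix.toLin' (bidentLap n dx dy d) (bidentBasis n 0) =
      (dx : ℤ) • bidentBasis n 0 - bidentBasis n 2 := by
  ext i
  have := toLin'_bidentLap_apply n dx dy d ⟨0, by omega⟩ i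
  simp only at this
  rw [this]
  simp only [bidentAdj, bidentBasis, Pi.sub_apply, Pi.smul_apply, smul_eq_mul]
  grind

lemma toLin'_bidentLap_one {n : ℕ} (hn : 3 ≤ n) (dx dy : ℕ) (d : ℕ → ℕ) :
    Matrix.toLin' (bidentLap n dx dy d) (bidentBasis n 1) =
      (dy : ℤ) • bidentBasis n 1 - bidentBasis n 2 := by
  ext i
  have := toLin'_bidentLap_apply n dx dy d ⟨1, by omega⟩ i
  simp only at this
  rw [this]
  simp only [bidentAdj, bidentBasis, Pi.sub_apply, Pi.smul_apply, smul_eq_mul]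
  grind

lemma toLin'_bidentLap_two {n : ℕ} (hn : 3 ≤ n) (dx dy : ℕ) (d : ℕ → ℕ) :
    Matrix.toLin' (bidentLap n dx dy d) (bidentBasis n 2) =
      (d 0 : ℤ) • bidentBasis n 2 - bidentBasis n 0 - bidentBasis n 1 - bidentBasis n 3 := by
  ext i
  have := toLin'_bidentLap_apply n dx dy d ⟨2, by omega⟩ i
  simp only at this
  rw [this]
  simp only [bidentAdj, bidentBasis, Pi.sub_apply, Pi.smul_apply, smul_eq_mul]
  grind

lemma toLin'_bidentLap_add_three {n k : ℕ} (hk : k + 3 < n) (dx dy : ℕ) (d : ℕ → ℕ) :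
    Matrix.toLin' (bidentLap n dx dy d) (bidentBasis n (k + 3)) =
      (d (k + 1) : ℤ) • bidentBasis n (k + 3) - bidentBasis n (k + 2) - bidentBasis n (k + 4) := by
  ext i
  have := toLin'_bidentLap_apply n dx dy d ⟨k + 3, hk⟩ i
  simp only at this
  rw [this]
  simp only [bidentAdj, bidentBasis, Pi.sub_apply, Pi.smul_apply, smul_eq_mul]
  grind

/-- In the cokernel of the Laplacian, the classes of `v_x` and `v_y` generate. -/
lemma mkQ_mem_span_prongs {n : ℕ} (hn : 3 ≤ n) (dx dy : ℕ) (d : ℕ → ℕ) (x : Fin n → ℤ) :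
    (LinearMap.range (Matrix.toLin' (bidentLap n dx dy d))).mkQ x ∈
      Submodule.span ℤ
        {(LinearMap.range (Matrix.toLin' (bidentLap n dx dy d))).mkQ (bidentBasis n 0),
          (LinearMap.range (Matrix.toLin' (bidentLap n dx dy d))).mkQ (bidentBasis n 1)} := by
  set π := (LinearMap.range (Matrix.toLin' (bidentLap n dx dy d))).mkQ with hπ
  set S := Submodule.span ℤ {π (bidentBasis n 0), π (bidentBasis n 1)}
  have hker (y : Fin n → ℤ) : π (Matrix.toLin' (bidentLap n dx dy d) y) = 0 := by
    simp [hπ]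
  have h0 : π (bidentBasis n 0) ∈ S := Submodule.subset_span (by simp)
  have h1 : π (bidentBasis n 1) ∈ S := Submodule.subset_span (by simp)
  have h2 : π (bidentBasis n 2) ∈ S := by
    have := hker (bidentBasis n 0)
    rw [toLin'_bidentLap_zero hn, map_sub, map_smul, sub_eq_zero] at this
    exact this ▸ S.smul_mem _ h0
  have h3 : π (bidentBasis n 3) ∈ S := by
    have := hker (bidentBasis n 2)
    rw [toLin'_bidentLap_two hn, map_sub, map_sub, map_sub, map_smul, sub_eq_zero] at this
    exact this ▸ S.sub_mem (S.sub_mem (S.smul_mem _ h2) h0) h1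
  have hpath (k : ℕ) : π (bidentBasis n (k + 2)) ∈ S ∧ π (bidentBasis n (k + 3)) ∈ S := by
    induction k with
    | zero => exact ⟨h2, h3⟩
    | succ k ih =>
      refine ⟨ih.2, ?_⟩
      rcases lt_or_ge (k + 3) n with hk | hk
      · have := hker (bidentBasis n (k + 3))
        rw [toLin'_bidentLap_add_three hk, map_sub, map_sub, map_smul, sub_eq_zero] at this
        exact this ▸ S.sub_mem (S.smul_mem _ ih.2) ih.1
      · rw [bidentBasis_of_le (by omega), map_zero]
        exact S.zero_mem
  have hall (k : ℕ) : π (bidentBasis n k) ∈ S := by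
    match k with
    | 0 => exact h0
    | 1 => exact h1
    | k + 2 => exact (hpath k).1
  rw [pi_eq_sum_univ' x, map_sum]
  refine S.sum_mem fun j _ => ?_
  rw [map_smul]
  refine S.smul_mem _ ?_
  convert hall j using 2
  rw [bidentBasis_eq_single]

/-- The entries of `r`, listed in the vertex order of `bidentLap`. -/
def bidentWeight (rx ry : ℕ) (r : ℕ → ℕ) : ℕ → ℤ
  | 0 => rx
  | 1 => ry
  | k + 2 => r k

/-- The linear functional on `ℤ^n` given by pairing with `r`. -/
def bidentPairing (n rx ry : ℕ) (r : ℕ → ℕ) : (Fin n → ℤ) →ₗ[ℤ] ℤ :=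
  Fintype.linearCombination ℤ fun i : Fin n => bidentWeight rx ry r i

lemma bidentPairing_basis {n k : ℕ} (hk : k < n) (rx ry : ℕ) (r : ℕ → ℕ) :
    bidentPairing n rx ry r (bidentBasis n k) = bidentWeight rx ry r k := by
  have := bidentBasis_eq_single (⟨k, hk⟩ : Fin n)
  simp only at this
  rw [this, bidentPairing, Fintype.linearCombination_apply_single, one_smul]

lemma bidentPairing_comp_toLin' {n dx dy rx ry : ℕ} {d r : ℕ → ℕ}
    (h : IsArith n dx dy d rx ry r) :
    bidentPairing n rx ry r ∘ₗ Matrix.toLin' (bidentLap n dx dy d) = 0 := by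
  obtain ⟨hn, -, -, -, -, -, -, hx, hy, h0, h0', hi, hl, -⟩ := h
  have hz (k : ℕ) (hk : n ≤ k) : bidentPairing n rx ry r (bidentBasis n k) = 0 := by
    rw [bidentBasis_of_le hk, map_zero]
  have key (k : ℕ) (hk : k < n) : bidentPairing n rx ry r
      (Matrix.toLin' (bidentLap n dx dy d) (bidentBasis n k)) = 0 := by
    match k with
    | 0 =>
      rw [toLin'_bidentLap_zero hn, map_sub, map_smul, bidentPairing_basis (by omega),
        bidentPairing_basis (by omega), smul_eq_mul, sub_eq_zero]
      simp only [bidentWeight]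
      exact_mod_cast hx
    | 1 =>
      rw [toLin'_bidentLap_one hn, map_sub, map_smul, bidentPairing_basis (by omega),
        bidentPairing_basis (by omega), smul_eq_mul, sub_eq_zero]
      simp only [bidentWeight]
      exact_mod_cast hy
    | 2 =>
      rw [toLin'_bidentLap_two hn, map_sub, map_sub, map_sub, map_smul,
        bidentPairing_basis (by omega), bidentPairing_basis (by omega),
        bidentPairing_basis (by omega), smul_eq_mul]
      simp only [bidentWeight]
      rcases Nat.lt_or_ge 3 n with h3 | h3
      · rw [bidentPairing_basis h3]
        have := h0 (by omega)
        simp only [bidentWeight]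
        zify at this
        linarith
      · rw [hz 3 h3]
        have := h0' (by omega)
        zify at this
        linarith
    | k + 3 =>
      rw [toLin'_bidentLap_add_three hk, map_sub, map_sub, map_smul,
        bidentPairing_basis hk, bidentPairing_basis (by omega), smul_eq_mul]
      simp only [bidentWeight]
      rcases Nat.lt_or_ge (k + 4) n with h4 | h4
      · rw [bidentPairing_basis h4]
        have := hi (k + 1) (by omega) (by omega)
        simp only [bidentWeight]
        simp only [Nat.add_sub_cancel] at this
        zify at this
        linarith
      · rw [hz _ h4]
        have := hl (by omega)
        rw [show n - 3 = k + 1 by omega, Nat.add_sub_cancel] at this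
        zify at this
        linarith
  refine LinearMap.pi_ext' fun j => LinearMap.ext_ring ?_
  simpa [bidentBasis_eq_single] using key j j.isLt

/-- If a module over `ℤ` is generated by `a` and `b`, and some functional to `ℤ` does not vanish
at `a`, then the torsion submodule is cyclic. -/
lemma isAddCyclic_torsion_of_span_pair {M : Type*} [AddCommGroup M] {a b : M}
    (hab : ∀ m : M, m ∈ Submodule.span ℤ {a, b}) (f : M →ₗ[ℤ] ℤ) (ha : f a ≠ 0) :
    IsAddCyclic (Submodule.torsion ℤ M) := by
  obtain ⟨g, u, v, hg, huv, hu, hv⟩ := Int.exists_gcd_one' (m := f a) (n := f b)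
    (Int.gcd_pos_of_ne_zero_left _ ha)
  have hg' : (g : ℤ) ≠ 0 := by exact_mod_cast hg.ne'
  have hu0 : u ≠ 0 := by rintro rfl; simp [hu] at ha
  have hle : (Submodule.torsion ℤ M).toAddSubgroup ≤ AddSubgroup.zmultiples (v • a - u • b) := by
    intro m hm
    obtain ⟨c, hc⟩ := (Submodule.mem_torsion_iff m).1 hm
    obtain ⟨p, q, rfl⟩ := Submodule.mem_span_pair.1 (hab m)
    have hf : f (p • a + q • b) = 0 := by
      have := congrArg f hc
      rw [Submonoid.smul_def, map_smul, map_zero, smul_eq_mul] at this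
      exact (mul_eq_zero.1 this).resolve_left (nonZeroDivisors.coe_ne_zero c)
    have hpq : p * u + q * v = 0 := by
      rw [map_add, map_smul, map_smul, hu, hv, smul_eq_mul, smul_eq_mul] at hf
      apply mul_right_cancel₀ hg'
      linarith
    obtain ⟨t, rfl⟩ : u ∣ q :=
      (Int.isCoprime_iff_gcd_eq_one.2 huv).dvd_of_dvd_mul_right ⟨-p, by linarith⟩
    obtain rfl : p = -(t * v) := by
      apply mul_right_cancel₀ hu0
      linarith
    refine AddSubgroup.mem_zmultiples_iff.2 ⟨-t, ?_⟩
    module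
  exact isAddCyclic_of_injective (AddSubgroup.inclusion hle) (AddSubgroup.inclusion_injective hle)

/-- **Proposition 5.1.**  Let `n ≥ 3`.  The critical group of any arithmetical structure on
the bident `D_n` is cyclic. -/
theorem critGroup_cyclic (n : ℕ) (hn : 3 ≤ n) (dx dy rx ry : ℕ) (d r : ℕ → ℕ)
    (h : IsArith n dx dy d rx ry r) :
    IsAddCyclic (critGroup n dx dy d) := by
  refine isAddCyclic_torsion_of_span_pair (fun m => ?_)
    (Submodule.liftQ _ (bidentPairing n rx ry r)
      (LinearMap.range_le_ker_iff.2 (bidentPairing_comp_toLin' h)))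
    (a := Submodule.mkQ _ (bidentBasis n 0)) (b := Submodule.mkQ _ (bidentBasis n 1)) ?_
  · obtain ⟨x, rfl⟩ := Submodule.mkQ_surjective _ m
    exact mkQ_mem_span_prongs hn dx dy d x
  · rw [Submodule.mkQ_apply, Submodule.liftQ_apply, bidentPairing_basis (by omega)]
    have : 0 < rx := h.2.2.2.2.1
    simpa [bidentWeight] using this.ne'
end

section
/- Let n ≥ 4, set ℓ = n − 3, and let (d, r) be an arithmetical structure on the bident D_n. Then the critical group K(D_n; d, r) is finite of order |K(D_n; d, r)| = r_0/(r_x·r_y·r_ℓ); equivalently, |K(D_n; d, r)|·r_x·r_y·r_ℓ = r_0. -/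
/-- A family `f` in an additive group satisfies the column relations of `L(D_n, d)`, where
`n = m + 4`. -/
structure IsBidentRelation {A : Type*} [AddCommGroup A] (m dx dy : ℕ) (d : ℕ → ℕ)
    (f : ℕ → A) : Prop where
  prong_x : dx • f 0 = f 2
  prong_y : dy • f 1 = f 2
  center : d 0 • f 2 = f 0 + f 1 + f 3
  path : ∀ i < m, d (i + 1) • f (i + 3) = f (i + 2) + f (i + 4)
  leaf : d (m + 1) • f (m + 3) = f (m + 2)

theorem bidentLap_column {A : Type*} [AddCommGroup A] (n dx dy : ℕ) (d : ℕ → ℕ) (f : ℕ → A)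
    (j : Fin n) :
    ∑ i : Fin n, bidentLap n dx dy d i j • f i =
      (if (j : ℕ) = 0 then dx else if (j : ℕ) = 1 then dy else d ((j : ℕ) - 2)) • f j -
        ∑ i ∈ Finset.range n, if bidentAdj i j then f i else 0 := by
  rw [← Fin.sum_univ_eq_sum_range (fun i => if bidentAdj i j then f i else 0) n]
  simp only [bidentLap, Matrix.sub_apply, Matrix.of_apply, sub_smul, Finset.sum_sub_distrib]
  congr 1
  · rw [Finset.sum_eq_single j]
    · rw [Matrix.diagonal_apply_eq]
      split_ifs <;> simp
    · intro i _ hij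
      rw [Matrix.diagonal_apply_ne _ hij, zero_smul]
    · simp
  · refine Finset.sum_congr rfl fun i _ => ?_
    split_ifs <;> simp

theorem sum_bidentAdj_zero {A : Type*} [AddCommGroup A] (m : ℕ) (f : ℕ → A) :
    ∑ i ∈ Finset.range (m + 4), (if bidentAdj i 0 then f i else 0) = f 2 := by
  rw [Finset.sum_eq_single 2]
  · simp [bidentAdj]
  · intro i _ hi
    simp [bidentAdj, hi]
  · simp

theorem sum_bidentAdj_one {A : Type*} [AddCommGroup A] (m : ℕ) (f : ℕ → A) :
    ∑ i ∈ Finset.range (m + 4), (if bidentAdj i 1 then f i else 0) = f 2 := by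
  rw [Finset.sum_eq_single 2]
  · simp [bidentAdj]
  · intro i _ hi
    simp [bidentAdj, hi]
    omega
  · simp

theorem sum_bidentAdj_two {A : Type*} [AddCommGroup A] (m : ℕ) (f : ℕ → A) :
    ∑ i ∈ Finset.range (m + 4), (if bidentAdj i 2 then f i else 0) = f 0 + f 1 + f 3 := by
  have h : ∀ i ∈ Finset.range (m + 4), (if bidentAdj i 2 then f i else 0) =
      (if i = 0 then f i else 0) + (if i = 1 then f i else 0) + (if i = 3 then f i else 0) := by
    intro i _
    have : bidentAdj i 2 = true ↔ i = 0 ∨ i = 1 ∨ i = 3 := by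
      simp [bidentAdj]
      omega
    simp only [this]
    split_ifs <;> first | omega | simp
  rw [Finset.sum_congr rfl h]
  simp [Finset.sum_add_distrib]

theorem sum_bidentAdj_path {A : Type*} [AddCommGroup A] (n k : ℕ) (hk : k + 4 < n) (f : ℕ → A) :
    ∑ i ∈ Finset.range n, (if bidentAdj i (k + 3) then f i else 0) = f (k + 2) + f (k + 4) := by
  have h : ∀ i ∈ Finset.range n, (if bidentAdj i (k + 3) then f i else 0) =
      (if i = k + 2 then f i else 0) + (if i = k + 4 then f i else 0) := by
    intro i _
    have : bidentAdj i (k + 3) = true ↔ i = k + 2 ∨ i = k + 4 := by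
      simp [bidentAdj]
      omega
    simp only [this]
    split_ifs <;> first | omega | simp
  rw [Finset.sum_congr rfl h, Finset.sum_add_distrib, Finset.sum_ite_eq', Finset.sum_ite_eq',
    if_pos (Finset.mem_range.2 (by omega)), if_pos (Finset.mem_range.2 hk)]

theorem sum_bidentAdj_leaf {A : Type*} [AddCommGroup A] (m : ℕ) (f : ℕ → A) :
    ∑ i ∈ Finset.range (m + 4), (if bidentAdj i (m + 3) then f i else 0) = f (m + 2) := by
  have h : ∀ i ∈ Finset.range (m + 4), (if bidentAdj i (m + 3) then f i else 0) =
      if i = m + 2 then f i else 0 := by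
    intro i hi
    have := Finset.mem_range.1 hi
    have : bidentAdj i (m + 3) = true ↔ i = m + 2 := by
      simp [bidentAdj]
      omega
    simp only [this]
  rw [Finset.sum_congr rfl h, Finset.sum_ite_eq', if_pos (Finset.mem_range.2 (by omega))]

theorem isBidentRelation_iff {A : Type*} [AddCommGroup A] (m dx dy : ℕ) (d : ℕ → ℕ)
    (f : ℕ → A) :
    IsBidentRelation m dx dy d f ↔
      ∀ j : Fin (m + 4), ∑ i : Fin (m + 4), bidentLap (m + 4) dx dy d i j • f i = 0 := by
  simp only [bidentLap_column, sub_eq_zero]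
  constructor
  · rintro ⟨hx, hy, h0, hp, hl⟩ ⟨j, hj⟩
    match j, hj with
    | 0, _ => simpa [sum_bidentAdj_zero] using hx
    | 1, _ => simpa [sum_bidentAdj_one] using hy
    | 2, _ => simpa [sum_bidentAdj_two] using h0
    | k + 3, hj =>
      rcases Nat.lt_or_ge k m with hk | hk
      · simpa [sum_bidentAdj_path (m + 4) k (by omega)] using hp k hk
      · obtain rfl : k = m := by omega
        simpa [sum_bidentAdj_leaf] using hl
  · intro h
    refine ⟨?_, ?_, ?_, fun k hk => ?_, ?_⟩
    · simpa [sum_bidentAdj_zero] using h ⟨0, by omega⟩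
    · simpa [sum_bidentAdj_one] using h ⟨1, by omega⟩
    · simpa [sum_bidentAdj_two] using h ⟨2, by omega⟩
    · simpa [sum_bidentAdj_path (m + 4) k (by omega)] using h ⟨k + 3, by omega⟩
    · simpa [sum_bidentAdj_leaf] using h ⟨m + 3, by omega⟩

/-- The cokernel `ℤ^n / Image(L(D_n, d))`. -/
abbrev BidentCoker (n dx dy : ℕ) (d : ℕ → ℕ) : Type :=
  (Fin n → ℤ) ⧸ LinearMap.range (Matrix.toLin' (bidentLap n dx dy d))

/-- The class in the cokernel of the standard basis vector at vertex `i`. -/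
def cokerGen (n dx dy : ℕ) (d : ℕ → ℕ) (i : ℕ) : BidentCoker n dx dy d :=
  if h : i < n then Submodule.Quotient.mk (Pi.single ⟨i, h⟩ 1) else 0

theorem mk_eq_sum_cokerGen (n dx dy : ℕ) (d : ℕ → ℕ) (x : Fin n → ℤ) :
    (Submodule.Quotient.mk x : BidentCoker n dx dy d) =
      ∑ i : Fin n, x i • cokerGen n dx dy d i := by
  conv_lhs => rw [pi_eq_sum_univ' x]
  rw [← Submodule.mkQ_apply, map_sum]
  refine Finset.sum_congr rfl fun i _ => ?_
  rw [map_smul, cokerGen, dif_pos i.2, Submodule.mkQ_apply]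

theorem isBidentRelation_cokerGen (m dx dy : ℕ) (d : ℕ → ℕ) :
    IsBidentRelation m dx dy d (cokerGen (m + 4) dx dy d) := by
  rw [isBidentRelation_iff]
  intro j
  rw [← mk_eq_sum_cokerGen (x := fun i => bidentLap (m + 4) dx dy d i j),
    Submodule.Quotient.mk_eq_zero]
  refine ⟨Pi.single j 1, ?_⟩
  rw [Matrix.toLin'_apply, Matrix.mulVec_single_one]
  rfl

theorem IsBidentRelation.exists_linearMap {A : Type*} [AddCommGroup A] {m dx dy : ℕ} {d : ℕ → ℕ}
    {f : ℕ → A} (hf : IsBidentRelation m dx dy d f) :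
    ∃ φ : BidentCoker (m + 4) dx dy d →ₗ[ℤ] A,
      ∀ i < m + 4, φ (cokerGen (m + 4) dx dy d i) = f i := by
  rw [isBidentRelation_iff] at hf
  let F : (Fin (m + 4) → ℤ) →ₗ[ℤ] A := Fintype.linearCombination ℤ fun i : Fin (m + 4) => f i
  have hF : LinearMap.range (Matrix.toLin' (bidentLap (m + 4) dx dy d)) ≤ LinearMap.ker F := by
    rw [LinearMap.range_le_ker_iff]
    refine (Pi.basisFun ℤ (Fin (m + 4))).ext fun j => ?_
    simpa [F, Fintype.linearCombination_apply] using hf j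
  refine ⟨Submodule.liftQ _ F hF, fun i hi => ?_⟩
  rw [cokerGen, dif_pos hi, Submodule.liftQ_apply, Fintype.linearCombination_apply_single, one_smul]

theorem path_induction {P : ℕ → Prop} {m : ℕ} (h₁ : P (m + 1)) (h₀ : P m)
    (step : ∀ i < m, P (i + 1) → P (i + 2) → P i) : ∀ i ≤ m + 1, P i := by
  have h : ∀ k i, i + k = m → P i ∧ P (i + 1) := by
    intro k
    induction k with
    | zero => rintro i rfl; exact ⟨h₀, h₁⟩
    | succ k ih =>
      intro i hi
      obtain ⟨h₂, h₃⟩ := ih (i + 1) (by omega)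
      exact ⟨step i (by omega) h₂ h₃, h₂⟩
  intro i hi
  rcases Nat.lt_or_ge i (m + 1) with hlt | hge
  · exact (h (m - i) i (by omega)).1
  · obtain rfl : i = m + 1 := by omega
    exact h₁

theorem IsBidentRelation.eq_smul_leaf {A : Type*} [AddCommGroup A] {m dx dy : ℕ} {d : ℕ → ℕ}
    {f : ℕ → A} (hf : IsBidentRelation m dx dy d f) {c : ℕ → ℤ} (h₁ : c (m + 1) = 1)
    (h₀ : c m = d (m + 1)) (hc : ∀ i < m, d (i + 1) * c (i + 1) = c i + c (i + 2)) :
    ∀ i ≤ m + 1, f (i + 2) = c i • f (m + 3) := by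
  refine path_induction ?_ ?_ fun i hi h₂ h₃ => ?_
  · rw [h₁, one_smul]
  · rw [h₀, ← hf.leaf, natCast_zsmul]
  · rw [eq_sub_of_add_eq (hf.path i hi).symm, eq_sub_of_add_eq (hc i hi).symm, sub_smul, ← h₃,
      mul_smul, ← h₂, natCast_zsmul]

theorem card_torsion_of_two_generators {M : Type*} [AddCommGroup M] {p q : M}
    (hgen : ∀ z : M, ∃ α β : ℤ, z = α • p + β • q) {u v K : ℕ} (hv : 0 < v)
    (huv : Nat.Coprime u v) (hK : 0 < K) (φ : M →ₗ[ℤ] ℤ) (hp : φ p = u) (hq : φ q = v)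
    (ψ : M →ₗ[ℤ] ZMod K) (hψ : ψ ((v : ℤ) • p - (u : ℤ) • q) = 1)
    (ht : K • ((v : ℤ) • p - (u : ℤ) • q) = 0) :
    Finite (Submodule.torsion ℤ M) ∧ Nat.card (Submodule.torsion ℤ M) = K := by
  set t := (v : ℤ) • p - (u : ℤ) • q with ht_def
  have horder : addOrderOf t = K := by
    refine Nat.dvd_antisymm (addOrderOf_dvd_of_nsmul_eq_zero ht) ?_
    rw [← ZMod.natCast_eq_zero_iff, ← nsmul_one, ← hψ, ← map_nsmul, addOrderOf_nsmul_eq_zero,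
      map_zero]
  have hmem : ∀ z : M, z ∈ Submodule.torsion ℤ M ↔ z ∈ AddSubgroup.zmultiples t := by
    intro z
    rw [AddSubgroup.mem_zmultiples_iff, Submodule.mem_torsion_iff]
    constructor
    · rintro ⟨a, ha⟩
      have hφz : φ z = 0 := by
        have h := congrArg φ ha
        rw [Submonoid.smul_def, map_smul, map_zero, smul_eq_mul] at h
        exact (mul_eq_zero.1 h).resolve_left (nonZeroDivisors.ne_zero a.2)
      obtain ⟨α, β, rfl⟩ := hgen z
      rw [map_add, map_smul, map_smul, hp, hq, smul_eq_mul, smul_eq_mul] at hφz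
      have hdvd : (v : ℤ) ∣ α :=
        (Nat.isCoprime_iff_coprime.2 huv).symm.dvd_of_dvd_mul_right ⟨-β, by linarith⟩
      obtain ⟨s, rfl⟩ := hdvd
      have hβ : β = -(s * u) := by
        have hv' : (v : ℤ) ≠ 0 := by exact_mod_cast hv.ne'
        apply mul_left_cancel₀ hv'
        linarith
      refine ⟨s, ?_⟩
      rw [ht_def, hβ]
      module
    · rintro ⟨s, rfl⟩
      refine ⟨⟨(K : ℤ), mem_nonZeroDivisors_of_ne_zero (by exact_mod_cast hK.ne')⟩, ?_⟩
      rw [Submonoid.mk_smul, smul_comm, natCast_zsmul, ht, smul_zero]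
  let e : Submodule.torsion ℤ M ≃ AddSubgroup.zmultiples t := Equiv.subtypeEquivRight hmem
  have hcard : Nat.card (Submodule.torsion ℤ M) = K := by
    rw [Nat.card_congr e, Nat.card_zmultiples, horder]
  exact ⟨Nat.finite_of_card_ne_zero (by omega), hcard⟩

/-- The labels `r` of an arithmetical structure, as a function on all vertices. -/
def vertexLabel (rx ry : ℕ) (r : ℕ → ℕ) : ℕ → ℤ
  | 0 => rx
  | 1 => ry
  | i + 2 => r i

theorem IsArith.isBidentRelation {m dx dy rx ry : ℕ} {d r : ℕ → ℕ}
    (h : IsArith (m + 4) dx dy d rx ry r) :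
    IsBidentRelation m dx dy d (vertexLabel rx ry r) := by
  obtain ⟨-, -, -, -, -, -, -, hx, hy, h0, -, hp, hl, -⟩ := h
  simp only [Nat.reduceSubDiff] at *
  refine ⟨?_, ?_, ?_, fun i hi => ?_, ?_⟩ <;> simp only [nsmul_eq_mul, vertexLabel] <;> norm_cast
  · exact h0 (by omega)
  · exact hp (i + 1) (by omega) (by omega)
  · exact hl (by omega)

theorem IsBidentRelation.leaf_dvd {m dx dy : ℕ} {d : ℕ → ℕ} {f : ℕ → ℤ}
    (hf : IsBidentRelation m dx dy d f) {g : ℤ} (hg : g ∣ f (m + 3)) :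
    ∀ i ≤ m + 1, g ∣ f (i + 2) := by
  refine path_induction hg ?_ fun i hi h₂ h₃ => ?_
  · rw [← hf.leaf, nsmul_eq_mul]
    exact hg.mul_left _
  · rw [eq_sub_of_add_eq (hf.path i hi).symm, nsmul_eq_mul]
    exact (h₂.mul_left _).sub h₃

theorem IsBidentRelation.prongs_dvd {m dx dy : ℕ} {d : ℕ → ℕ} {f : ℕ → ℤ}
    (hf : IsBidentRelation m dx dy d f) {g : ℤ} (hx : g ∣ f 0) (hy : g ∣ f 1) :
    ∀ i ≤ m + 1, g ∣ f (i + 2) := by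
  have h0 : g ∣ f 2 := by
    rw [← hf.prong_x, nsmul_eq_mul]
    exact hx.mul_left _
  have h1 : g ∣ f 3 := by
    rw [eq_sub_of_add_eq' hf.center.symm, nsmul_eq_mul]
    exact (h0.mul_left _).sub (hx.add hy)
  have h : ∀ i ≤ m, g ∣ f (i + 2) ∧ g ∣ f (i + 3) := by
    intro i
    induction i with
    | zero => exact fun _ => ⟨h0, h1⟩
    | succ i ih =>
      intro hi
      obtain ⟨h₂, h₃⟩ := ih (by omega)
      refine ⟨h₃, ?_⟩
      rw [show i + 1 + 3 = i + 4 from rfl, eq_sub_of_add_eq' (hf.path i (by omega)).symm,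
        nsmul_eq_mul]
      exact (h₃.mul_left _).sub h₂
  intro i hi
  rcases Nat.lt_or_ge i (m + 1) with hlt | hge
  · exact (h i (by omega)).1
  · obtain rfl : i = m + 1 := by omega
    exact (h m le_rfl).2

theorem IsArith.pairwise_coprime {m dx dy rx ry : ℕ} {d r : ℕ → ℕ}
    (h : IsArith (m + 4) dx dy d rx ry r) :
    Nat.Coprime rx ry ∧ Nat.Coprime rx (r (m + 1)) ∧ Nat.Coprime ry (r (m + 1)) := by
  have hf := h.isBidentRelation
  obtain ⟨-, -, -, -, -, -, -, -, -, -, -, -, -, hgcd⟩ := h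
  have hcenter := hf.center
  simp only [vertexLabel, nsmul_eq_mul] at hcenter
  refine ⟨Nat.Coprime.symm ?_, Nat.Coprime.symm ?_, Nat.Coprime.symm ?_⟩ <;>
    refine Nat.coprime_of_dvd' fun g _ hg₁ hg₂ => ?_ <;> rw [Nat.dvd_one]
  · refine hgcd g hg₂ hg₁ fun i hi => ?_
    exact Int.natCast_dvd_natCast.1 <| hf.prongs_dvd (Int.natCast_dvd_natCast.2 hg₂)
      (Int.natCast_dvd_natCast.2 hg₁) i (by omega)
  · have hpath := hf.leaf_dvd (Int.natCast_dvd_natCast.2 hg₁)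
    refine hgcd g hg₂ ?_ fun i hi => Int.natCast_dvd_natCast.1 (hpath i (by omega))
    rw [← Int.natCast_dvd_natCast,
      show (ry : ℤ) = d 0 * r 0 - r 1 - rx by rw [hcenter]; ring]
    exact (((hpath 0 (by omega)).mul_left _).sub (hpath 1 (by omega))).sub
      (Int.natCast_dvd_natCast.2 hg₂)
  · have hpath := hf.leaf_dvd (Int.natCast_dvd_natCast.2 hg₁)
    refine hgcd g ?_ hg₂ fun i hi => Int.natCast_dvd_natCast.1 (hpath i (by omega))
    rw [← Int.natCast_dvd_natCast,
      show (rx : ℤ) = d 0 * r 0 - r 1 - ry by rw [hcenter]; ring]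
    exact (((hpath 0 (by omega)).mul_left _).sub (hpath 1 (by omega))).sub
      (Int.natCast_dvd_natCast.2 hg₂)

/-- The labels determining a second functional on the cokernel, valued in a quotient of `ℤ`. -/
def bezoutLabel (s a b : ℤ) (c : ℕ → ℤ) : ℕ → ℤ
  | 0 => b
  | 1 => s * a - b
  | i + 2 => c i * a

theorem cokerGen_generate {m dx dy : ℕ} {d : ℕ → ℕ} {s : ℤ} {c : ℕ → ℤ}
    (hy : cokerGen (m + 4) dx dy d 1 =
      s • cokerGen (m + 4) dx dy d (m + 3) - cokerGen (m + 4) dx dy d 0)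
    (hpath : ∀ i ≤ m + 1,
      cokerGen (m + 4) dx dy d (i + 2) = c i • cokerGen (m + 4) dx dy d (m + 3))
    (z : BidentCoker (m + 4) dx dy d) :
    ∃ α β : ℤ, z = α • cokerGen (m + 4) dx dy d 0 + β • cokerGen (m + 4) dx dy d (m + 3) := by
  suffices z ∈ Submodule.span ℤ {cokerGen (m + 4) dx dy d 0, cokerGen (m + 4) dx dy d (m + 3)} by
    obtain ⟨α, β, h⟩ := Submodule.mem_span_pair.1 this
    exact ⟨α, β, h.symm⟩
  obtain ⟨x, rfl⟩ := Submodule.Quotient.mk_surjective _ z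
  rw [mk_eq_sum_cokerGen]
  refine Submodule.sum_mem _ fun ⟨i, hi⟩ _ => Submodule.smul_mem _ _ ?_
  have h0 : cokerGen (m + 4) dx dy d 0 ∈ Submodule.span ℤ
    {cokerGen (m + 4) dx dy d 0, cokerGen (m + 4) dx dy d (m + 3)} :=
      Submodule.subset_span (by simp)
  have hl : cokerGen (m + 4) dx dy d (m + 3) ∈ Submodule.span ℤ
    {cokerGen (m + 4) dx dy d 0, cokerGen (m + 4) dx dy d (m + 3)} :=
      Submodule.subset_span (by simp)
  match i, hi with
  | 0, _ => exact h0
  | 1, _ =>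
    rw [hy]
    exact Submodule.sub_mem _ (Submodule.smul_mem _ _ hl) h0
  | i + 2, hi =>
    change cokerGen (m + 4) dx dy d (i + 2) ∈ _
    rw [hpath i (by omega)]
    exact Submodule.smul_mem _ _ hl

/-- **Corollary 5.3.**  Let `n ≥ 4`, `ℓ = n - 3`, and let `(d, r)` be an arithmetical
structure on the bident `D_n`.  The critical group is finite of order
`r_0 / (r_x · r_y · r_ℓ)`; equivalently, `|K(D_n; d, r)| · r_x · r_y · r_ℓ = r_0`. -/
theorem critGroup_order (n : ℕ) (hn : 4 ≤ n) (dx dy rx ry : ℕ) (d r : ℕ → ℕ)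
    (h : IsArith n dx dy d rx ry r) :
    Finite (critGroup n dx dy d) ∧
    Nat.card (critGroup n dx dy d) * (rx * ry * r (n - 3)) = r 0 := by
  obtain ⟨m, rfl⟩ : ∃ m, n = m + 4 := ⟨n - 4, by omega⟩
  have hr := h.isBidentRelation
  obtain ⟨hxy, hxl, hyl⟩ := h.pairwise_coprime
  obtain ⟨-, -, -, -, hrx, hry, hrpos, hdx, hdy, -, -, -, -, -⟩ := h
  change Finite (critGroup (m + 4) dx dy d) ∧
    Nat.card (critGroup (m + 4) dx dy d) * (rx * ry * r (m + 1)) = r 0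
  have hrl : 0 < r (m + 1) := hrpos (m + 1) (by omega)
  have hdvd := hr.leaf_dvd (dvd_refl _)
  obtain ⟨K, hK⟩ : rx * ry * r (m + 1) ∣ r 0 := by
    refine (Nat.Coprime.mul_left hxl hyl).mul_dvd_of_dvd_of_dvd
      (hxy.mul_dvd_of_dvd_of_dvd ⟨dx, by rw [← hdx, mul_comm]⟩ ⟨dy, by rw [← hdy, mul_comm]⟩) ?_
    exact Int.natCast_dvd_natCast.1 (hdvd 0 (by omega))
  have hKpos : 0 < K := by
    have := hrpos 0 (by omega)
    rw [hK] at this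
    exact Nat.pos_of_mul_pos_left this
  choose! c hc using hdvd
  have hrl' : (r (m + 1) : ℤ) ≠ 0 := by exact_mod_cast hrl.ne'
  have hrx' : (rx : ℤ) ≠ 0 := by exact_mod_cast hrx.ne'
  have hry' : (ry : ℤ) ≠ 0 := by exact_mod_cast hry.ne'
  have hK' : (r 0 : ℤ) = rx * ry * r (m + 1) * K := by exact_mod_cast hK
  have hdx' : (dx : ℤ) * rx = r 0 := by exact_mod_cast hdx
  have hdy' : (dy : ℤ) * ry = r 0 := by exact_mod_cast hdy
  simp only [vertexLabel] at hc
  have hc_leaf : c (m + 1) = 1 := mul_left_cancel₀ hrl' (by rw [← hc _ le_rfl, mul_one])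
  have hc_pre : c m = d (m + 1) := by
    have := hr.leaf
    simp only [vertexLabel, nsmul_eq_mul] at this
    apply mul_left_cancel₀ hrl'
    rw [← hc _ (by omega), ← this, mul_comm]
  have hc_path : ∀ i < m, d (i + 1) * c (i + 1) = c i + c (i + 2) := by
    intro i hi
    have := hr.path i hi
    simp only [vertexLabel, nsmul_eq_mul] at this
    rw [hc _ (by omega), hc i (by omega), hc (i + 2) (by omega)] at this
    apply mul_left_cancel₀ hrl'
    linear_combination this
  have hs : r (m + 1) * (d 0 * c 0 - c 1) = (rx : ℤ) + ry := by
    have := hr.center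
    simp only [vertexLabel, nsmul_eq_mul] at this
    rw [hc 0 (by omega), hc 1 (by omega)] at this
    linear_combination this
  have hdx_eq : (dx : ℤ) = K * ry * r (m + 1) := by
    apply mul_left_cancel₀ hrx'
    linear_combination hdx' + hK'
  have hdy_eq : (dy : ℤ) = K * rx * r (m + 1) := by
    apply mul_left_cancel₀ hry'
    linear_combination hdy' + hK'
  have hc0 : c 0 = K * rx * ry := by
    apply mul_left_cancel₀ hrl'
    rw [← hc 0 (by omega), hK']
    ring
  obtain ⟨a', b, hab⟩ := Nat.isCoprime_iff_coprime.2 hxl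
  have he := isBidentRelation_cokerGen m dx dy d
  have he_path := he.eq_smul_leaf hc_leaf hc_pre hc_path
  set e := cokerGen (m + 4) dx dy d
  have hey : e 1 = (d 0 * c 0 - c 1) • e (m + 3) - e 0 := by
    have := he.center
    rw [he_path 0 (by omega), he_path 1 (by omega), ← natCast_zsmul] at this
    rw [sub_smul, mul_smul, this]
    abel
  obtain ⟨φ, hφ⟩ := hr.exists_linearMap
  have hg : IsBidentRelation m dx dy d
      (fun i => (bezoutLabel (d 0 * c 0 - c 1) (-a') b c i : ZMod K)) := by
    have hKz : (K : ZMod K) = 0 := ZMod.natCast_self K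
    have hzero : ∀ x y w : ℤ, x - y = K * w → (x : ZMod K) = y := by
      intro x y w hw
      have := congrArg (Int.cast : ℤ → ZMod K) hw
      push_cast at this
      rwa [hKz, zero_mul, sub_eq_zero] at this
    refine ⟨?_, ?_, ?_, fun i hi => ?_, ?_⟩ <;>
      simp only [nsmul_eq_mul, bezoutLabel] <;> norm_cast
    · refine hzero _ _ ry ?_
      rw [hdx_eq, hc0]
      linear_combination (K * ry : ℤ) * hab
    · refine hzero _ _ (-rx) ?_
      rw [hdy_eq]
      linear_combination (a' : ℤ) * hc0 - (K * rx * a' : ℤ) * hs - (K * rx : ℤ) * hab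
    · congr 1
      ring
    · congr 1
      linear_combination (-a') * hc_path i hi
    · congr 1
      rw [hc_leaf, hc_pre]
      ring
  obtain ⟨ψ, hψ⟩ := hg.exists_linearMap
  have hKt : K • ((r (m + 1) : ℤ) • e 0 - (rx : ℤ) • e (m + 3)) = 0 := by
    have he0 := he_path 0 (by omega)
    have h₁ : (K * ry) • ((r (m + 1) : ℤ) • e 0 - (rx : ℤ) • e (m + 3)) = 0 := by
      have hx := he.prong_x
      rw [he0, ← natCast_zsmul, hdx_eq, hc0, ← sub_eq_zero] at hx
      rw [← hx]
      module
    have h₂ : (K * rx) • ((r (m + 1) : ℤ) • e 0 - (rx : ℤ) • e (m + 3)) = 0 := by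
      have hy := he.prong_y
      rw [he0, ← natCast_zsmul, hey, smul_sub, smul_smul, hdy_eq, mul_assoc _ _ (_ - _), hs, hc0,
        ← sub_eq_zero] at hy
      rw [← neg_eq_zero, ← hy]
      module
    have h₃ := Nat.dvd_gcd (addOrderOf_dvd_of_nsmul_eq_zero h₂) (addOrderOf_dvd_of_nsmul_eq_zero h₁)
    rw [Nat.gcd_mul_left, hxy.gcd_eq_one, mul_one] at h₃
    exact addOrderOf_dvd_iff_nsmul_eq_zero.1 h₃
  obtain ⟨hfin, hcard⟩ := card_torsion_of_two_generators (cokerGen_generate hey he_path) hrl hxl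
    hKpos φ (hφ 0 (by omega)) (hφ (m + 3) (by omega)) ψ (by
      rw [map_sub, map_smul, map_smul, hψ 0 (by omega), hψ (m + 3) (by omega)]
      have := congrArg (Int.cast : ℤ → ZMod K) hab
      simp only [bezoutLabel, hc_leaf, zsmul_eq_mul]
      push_cast at this ⊢
      linear_combination this) hKt
  refine ⟨hfin, ?_⟩
  rw [show Nat.card (critGroup (m + 4) dx dy d) = K from hcard, hK, mul_comm]
end
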